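/- arXiv:1401.6221 — 8 statements merged into one kernel-verified Lean document; each statement's English description precedes it below -/
import Mathlib

section
/- Let d ≥ 1 and let f : ℝ^d × ℝ^d → ℂ be continuous, compactly supported in its first variable, and 2π-periodic in each coordinate of its second variable. Then there exists ε₀ > 0 such that for every ε with 0 < ε < ε₀ one has (∫_{ℝ^d} |f(x, x/ε)|² dx)^{1/2} ≤ π^{−d/2} (∫_{ℝ^d} ∫_{[−π,π]^d} |f(x,y)|² dy dx)^{1/2}. -/
open MeasureTheory
open scoped Pointwise
lemma unif {d : ℕ} (g : (Fin d → ℝ) → (Fin d → ℝ) → ℝ)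
    (hc : Continuous (fun p : (Fin d → ℝ) × (Fin d → ℝ) => g p.1 p.2))
    (K : Set (Fin d → ℝ)) (hK : IsCompact K) (h0 : ∀ x ∉ K, ∀ y, g x y = 0)
    (hper : ∀ x y : Fin d → ℝ, ∀ k : Fin d → ℤ,
      g x (y + fun i => 2 * Real.pi * (k i : ℝ)) = g x y) (δ : ℝ) (hδ : 0 < δ) :
    ∃ η > (0:ℝ), η ≤ 1 ∧ ∀ w : Fin d → ℝ, ‖w‖ < η → ∀ x y, 
      g (x + w) y ≤ g x y + (Metric.cthickening 1 K).indicator (fun _ => δ) x := by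
  have hK1 : IsCompact (Metric.cthickening 1 K) := hK.cthickening
  set Q := Set.Icc (fun _ : Fin d => -Real.pi) (fun _ : Fin d => Real.pi) with hQ
  have hQc : IsCompact Q := isCompact_Icc
  have key : ∀ᶠ w in nhds (0 : Fin d → ℝ), ∀ p ∈ (Metric.cthickening 1 K) ×ˢ Q,
      g (p.1 + w) p.2 < g p.1 p.2 + δ := by
    apply (hK1.prod hQc).eventually_forall_of_forall_eventually
    intro p _
    have h1 : Continuous (fun z : (Fin d → ℝ) × ((Fin d → ℝ) × (Fin d → ℝ)) => 
      g (z.2.1 + z.1) z.2.2) := 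
      hc.comp (f := fun z : (Fin d → ℝ) × ((Fin d → ℝ) × (Fin d → ℝ)) => (z.2.1 + z.1, z.2.2)) (by fun_prop)
    have h2 : Continuous (fun z : (Fin d → ℝ) × ((Fin d → ℝ) × (Fin d → ℝ)) => 
      g z.2.1 z.2.2 + δ) := 
      (hc.comp continuous_snd).add continuous_const
    exact (isOpen_lt h1 h2).mem_nhds (by simp [hδ])
  obtain ⟨η, hη, H⟩ := Metric.eventually_nhds_iff.1 key
  refine ⟨min η 1, by positivity, min_le_right _ _, fun w hw x y => ?_⟩
  by_cases hx : x ∈ Metric.cthickening 1 K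
  · rw [Set.indicator_of_mem hx]
    have : ∀ i, ∃ k : ℤ, y i + 2 * Real.pi * k ∈ Set.Icc (-Real.pi) Real.pi := by
      intro i
      obtain ⟨k, hk, -⟩ := existsUnique_add_zsmul_mem_Ico Real.two_pi_pos (y i) (-Real.pi)
      refine ⟨k, ?_⟩
      simp only [zsmul_eq_mul, Set.mem_Ico] at hk
      constructor <;> linarith
    choose k hk using this
    rw [← hper x y k, ← hper (x+w) y k]
    refine (H (y := w) ?_ (x, y + fun i => 2 * Real.pi * (k i : ℝ)) ⟨hx, ?_⟩).le
    · simpa using hw.trans_le (min_le_left _ _)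
    · exact ⟨fun i => (hk i).1, fun i => (hk i).2⟩
  · rw [Set.indicator_of_notMem hx]
    have h1 : x + w ∉ K := by
      intro h
      apply hx
      apply Metric.mem_cthickening_of_dist_le x (x+w) _ _ h
      simpa using (hw.trans_le (min_le_right _ _)).le
    have h2 : x ∉ K := fun h => hx (Metric.self_subset_cthickening _ h)
    rw [h0 _ h1, h0 _ h2]; simp

lemma cube_trans {d : ℕ} (g : (Fin d → ℝ) → ℝ)
    (hper : ∀ y : Fin d → ℝ, ∀ k : Fin d → ℤ,
      g (y + fun i => 2 * Real.pi * (k i : ℝ)) = g y) (a : Fin d → ℝ) :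
    ∫ z in Set.Icc (fun _ : Fin d => -Real.pi) (fun _ : Fin d => Real.pi), g (a + z) =
    ∫ z in Set.Icc (fun _ : Fin d => -Real.pi) (fun _ : Fin d => Real.pi), g z := by
  let b : Module.Basis (Fin d) ℝ (Fin d → ℝ) := (Pi.basisFun ℝ (Fin d)).isUnitSMul 
    (w := fun _ => 2 * Real.pi) (fun _ => (IsUnit.mk0 _ Real.two_pi_pos.ne'))
  have hb : ∀ i, b i = Pi.single i (2 * Real.pi) := by
    intro i
    simp [b, Module.Basis.isUnitSMul_apply, ← Pi.single_smul]
  have hF := ZSpan.isAddFundamentalDomain' b volume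
  have hrep : ∀ x i, b.repr x i = x i / (2 * Real.pi) := by
    intro x i
    have := Module.Basis.repr_isUnitSMul (v := Pi.basisFun ℝ (Fin d)) 
      (w := fun _ => 2 * Real.pi) (fun _ => (IsUnit.mk0 _ Real.two_pi_pos.ne')) x i
    rw [this]
    simp [Units.smul_def, div_eq_inv_mul]
  have hFe : ∀ c : Fin d → ℝ, c +ᵥ ZSpan.fundamentalDomain b = 
      Set.univ.pi fun i => Set.Ico (c i) (c i + 2 * Real.pi) := by
    intro c
    ext x
    rw [Set.mem_vadd_set_iff_neg_vadd_mem, ZSpan.mem_fundamentalDomain]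
    simp only [hrep, Set.mem_pi, Set.mem_univ, true_imp_iff]
    refine forall_congr' fun i => ?_
    have hp := Real.two_pi_pos
    simp only [Set.mem_Ico, vadd_eq_add, Pi.add_apply, Pi.neg_apply]
    rw [le_div_iff₀ hp, div_lt_iff₀ hp]
    constructor <;> rintro ⟨h1, h2⟩ <;> constructor <;> linarith
  have hFd : ∀ c : Fin d → ℝ, IsAddFundamentalDomain (Submodule.span ℤ (Set.range b)).toAddSubgroup
      (Set.univ.pi fun i => Set.Ico (c i) (c i + 2 * Real.pi)) volume := by
    intro c
    rw [← hFe]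
    exact hF.vadd_of_comm c
  have hinv : ∀ (v : (Submodule.span ℤ (Set.range b)).toAddSubgroup) (x : Fin d → ℝ), g (v +ᵥ x) = g x := by
    rintro ⟨v, hv⟩ x
    have hv' : v ∈ Submodule.span ℤ (Set.range b) := hv
    have hk := (b.mem_span_iff_repr_mem ℤ v).1 hv'
    simp only [hrep] at hk
    choose k hk using hk
    have : v = fun i => 2 * Real.pi * (k i : ℝ) := by
      ext i
      have := hk i
      simp only [algebraMap_int_eq, eq_intCast] at this
      rw [this]; field_simp
    change g (v + x) = _
    rw [add_comm, this, hper]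
  have hae : ∀ c : Fin d → ℝ, (Set.univ.pi fun i => Set.Ico (c i) (c i + 2 * Real.pi)) =ᵐ[volume] 
     Set.Icc c (fun i => c i + 2 * Real.pi) := fun c => Measure.univ_pi_Ico_ae_eq_Icc
  have : Countable (Submodule.span ℤ (Set.range b)).toAddSubgroup := countable_of_Lindelof_of_discrete
  have h1 := (hFd fun _ => -Real.pi).setIntegral_eq (hFd fun i => a i - Real.pi) hinv
  rw [setIntegral_congr_set (hae _), setIntegral_congr_set (hae _)] at h1
  have e : (fun _ : Fin d => Real.pi) = fun i => -Real.pi + 2 * Real.pi := by ext; ring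
  rw [e, h1]
  have := (measurePreserving_add_left volume a).setIntegral_preimage_emb 
    (measurableEmbedding_addLeft a) g (Set.Icc (fun i => a i - Real.pi) (fun i => a i - Real.pi + 2 * Real.pi))
  rw [← this]
  congr 2
  ext z
  simp only [Set.mem_Icc, Pi.le_def, Set.mem_preimage, Pi.add_apply, ← forall_and]
  refine forall_congr' fun i => ?_
  constructor <;> rintro ⟨h1, h2⟩ <;> constructor <;> linarith

lemma integ {d : ℕ} (F : (Fin d → ℝ) × (Fin d → ℝ) → ℝ) (hF : Continuous F)
    (K Q : Set (Fin d → ℝ)) (hK : IsCompact K) (hQ : IsCompact Q) 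
    (h0 : ∀ x ∉ K, ∀ y ∈ Q, F (x, y) = 0) :
    Integrable F ((volume : Measure (Fin d → ℝ)).prod (volume.restrict Q)) := by
  have e : (volume : Measure (Fin d → ℝ)).prod (volume.restrict Q) = 
    (volume : Measure ((Fin d → ℝ) × (Fin d → ℝ))).restrict (Set.univ ×ˢ Q) := by
    rw [Measure.volume_eq_prod, ← Measure.prod_restrict, Measure.restrict_univ]
  rw [e]
  have h1 : IntegrableOn F (K ×ˢ Q) := hF.continuousOn.integrableOn_compact (hK.prod hQ)
  refine h1.of_forall_sdiff_eq_zero (MeasurableSet.univ.prod hQ.measurableSet) ?_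
  rintro ⟨x, y⟩ ⟨⟨_, hy⟩, h⟩
  exact h0 x (fun hx => h ⟨hx, hy⟩) y hy

lemma approx {d : ℕ} (g : (Fin d → ℝ) → (Fin d → ℝ) → ℝ)
    (hc : Continuous (fun p : (Fin d → ℝ) × (Fin d → ℝ) => g p.1 p.2))
    (K : Set (Fin d → ℝ)) (hK : IsCompact K) (h0 : ∀ x ∉ K, ∀ y, g x y = 0)
    (hper : ∀ x y : Fin d → ℝ, ∀ k : Fin d → ℤ,
      g x (y + fun i => 2 * Real.pi * (k i : ℝ)) = g x y) (δ : ℝ) (hδ : 0 < δ) :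
    ∃ ε₀ > (0:ℝ), ∀ ε : ℝ, 0 < ε → ε < ε₀ →
      (2 * Real.pi) ^ d * (∫ x : Fin d → ℝ, g x (ε⁻¹ • x)) ≤
        (∫ x : Fin d → ℝ,
            ∫ y in Set.Icc (fun _ : Fin d => -Real.pi) (fun _ : Fin d => Real.pi), g x y) + δ := by
  set Q := Set.Icc (fun _ : Fin d => -Real.pi) (fun _ : Fin d => Real.pi) with hQ
  have hQc : IsCompact Q := isCompact_Icc
  set K1 := Metric.cthickening 1 K with hK1d
  have hK1 : IsCompact K1 := hK.cthickening
  have : IsFiniteMeasure (volume.restrict Q) := ⟨by simpa using hQc.measure_lt_top⟩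
  set ν := (volume : Measure (Fin d → ℝ)).prod (volume.restrict Q) with hν
  obtain ⟨η, hη, hη1, H⟩ := unif g hc K hK h0 hper (δ / (ν.real (K1 ×ˢ Set.univ) + 1)) (by positivity)
  have hpi := Real.pi_pos
  refine ⟨η / Real.pi, by positivity, fun ε hε hlt => ?_⟩
  have hz : ∀ z ∈ Q, ‖ε • z‖ < η := by
    intro z hz
    have : ‖z‖ ≤ Real.pi := by
      rw [pi_norm_le_iff_of_nonneg hpi.le]
      intro i
      exact abs_le.2 ⟨hz.1 i, hz.2 i⟩
    rw [norm_smul, Real.norm_of_nonneg hε.le]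
    rw [lt_div_iff₀ hpi] at hlt
    nlinarith
  have hFc : Continuous (fun p : (Fin d → ℝ) × (Fin d → ℝ) => g (p.1 + ε • p.2) (ε⁻¹ • p.1 + p.2)) :=
    hc.comp (f := fun p : (Fin d → ℝ) × (Fin d → ℝ) => (p.1 + ε • p.2, ε⁻¹ • p.1 + p.2)) (by fun_prop)
  have hHc : Continuous (fun p : (Fin d → ℝ) × (Fin d → ℝ) => g p.1 (ε⁻¹ • p.1 + p.2)) :=
    hc.comp (f := fun p : (Fin d → ℝ) × (Fin d → ℝ) => (p.1, ε⁻¹ • p.1 + p.2)) (by fun_prop)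
  have hFi : Integrable _ ν := integ _ hFc K1 Q hK1 hQc (by
    intro x hx z hzQ
    apply h0
    intro h
    apply hx
    apply Metric.mem_cthickening_of_dist_le x (x+ε • z) _ _ h
    simpa using ((hz z hzQ).trans_le hη1).le)
  have hHi : Integrable _ ν := integ _ hHc K Q hK hQc (fun x hx z _ => h0 x hx _)
  have hI : (2 * Real.pi) ^ d * (∫ x : Fin d → ℝ, g x (ε⁻¹ • x)) = 
      ∫ p, g (p.1 + ε • p.2) (ε⁻¹ • p.1 + p.2) ∂ν := by
    rw [integral_prod _ hFi, integral_integral_swap hFi]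
    have : ∀ z : Fin d → ℝ, ∫ x, g (x + ε • z) (ε⁻¹ • x + z) = ∫ x, g x (ε⁻¹ • x) := by
      intro z
      rw [← integral_add_right_eq_self (fun x => g x (ε⁻¹ • x)) (ε • z)]
      congr 1; ext x
      rw [smul_add, inv_smul_smul₀ hε.ne']
    simp only [this]
    rw [integral_const, smul_eq_mul]
    congr 1
    rw [measureReal_restrict_apply_univ, hQ, measureReal_def, Real.volume_Icc_pi_toReal]
    · simp; ring
    · intro i; simp; linarith
  have hJ : (∫ x : Fin d → ℝ, ∫ y in Q, g x y) = ∫ p, g p.1 (ε⁻¹ • p.1 + p.2) ∂ν := by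
    rw [integral_prod _ hHi]
    congr 1; ext x
    exact (cube_trans (g x) (hper x) (ε⁻¹ • x)).symm
  have hms : MeasurableSet (K1 ×ˢ (Set.univ : Set (Fin d → ℝ))) := hK1.measurableSet.prod .univ
  have hfin : ν (K1 ×ˢ Set.univ) ≠ ⊤ := by
    rw [hν, Measure.prod_prod]
    exact ENNReal.mul_ne_top hK1.measure_lt_top.ne (measure_ne_top _ _)
  set δ' := δ / (ν.real (K1 ×ˢ Set.univ) + 1) with hδ'
  have hind : Integrable ((K1 ×ˢ (Set.univ : Set (Fin d → ℝ))).indicator fun _ => δ') ν := by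
    rw [integrable_indicator_iff hms]
    exact integrableOn_const hfin
  rw [hI, hJ]
  have hQae : ∀ᵐ p ∂ν, p.2 ∈ Q := by
    have : ∀ᵐ z ∂(volume.restrict Q), z ∈ Q := ae_restrict_mem hQc.measurableSet
    exact Measure.quasiMeasurePreserving_snd.ae this
  calc _ ≤ ∫ p, (g p.1 (ε⁻¹ • p.1 + p.2) + (K1 ×ˢ (Set.univ : Set (Fin d → ℝ))).indicator (fun _ => δ') p) ∂ν := by
        refine integral_mono_ae hFi (hHi.add hind) ?_
        filter_upwards [hQae] with p hp
        refine (H _ (hz _ hp) p.1 _).trans (le_of_eq ?_)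
        by_cases hp1 : p.1 ∈ K1
        · rw [Set.indicator_of_mem hp1, Set.indicator_of_mem (show p ∈ K1 ×ˢ (Set.univ : Set (Fin d → ℝ)) from ⟨hp1, trivial⟩)]
        · rw [Set.indicator_of_notMem hp1, Set.indicator_of_notMem (fun h => hp1 h.1)]
    _ = (∫ p, g p.1 (ε⁻¹ • p.1 + p.2) ∂ν) + ν.real (K1 ×ˢ Set.univ) * δ' := by
        rw [integral_add hHi hind, integral_indicator hms, setIntegral_const, smul_eq_mul]
    _ ≤ _ := by
        gcongr
        rw [hδ', mul_div_assoc', div_le_iff₀ (by positivity)]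
        nlinarith [measureReal_nonneg (μ := ν) (s := K1 ×ˢ Set.univ)]

lemma zero_case {d : ℕ} (g : (Fin d → ℝ) → (Fin d → ℝ) → ℝ)
    (hc : Continuous (fun p : (Fin d → ℝ) × (Fin d → ℝ) => g p.1 p.2))
    (K : Set (Fin d → ℝ)) (hK : IsCompact K) (h0 : ∀ x ∉ K, ∀ y, g x y = 0)
    (hper : ∀ x y : Fin d → ℝ, ∀ k : Fin d → ℤ,
      g x (y + fun i => 2 * Real.pi * (k i : ℝ)) = g x y) (hn : ∀ x y, 0 ≤ g x y)
    (hJ : (∫ x : Fin d → ℝ,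
       ∫ y in Set.Icc (fun _ : Fin d => -Real.pi) (fun _ : Fin d => Real.pi), g x y) ≤ 0)
    (x₀ y₀ : Fin d → ℝ) : g x₀ y₀ = 0 := by
  by_contra hne
  set Q := Set.Icc (fun _ : Fin d => -Real.pi) (fun _ : Fin d => Real.pi) with hQ
  have hQc : IsCompact Q := isCompact_Icc
  have hpi := Real.pi_pos
  have hHc : Continuous (fun p : (Fin d → ℝ) × (Fin d → ℝ) => g p.1 (y₀ + p.2)) :=
    hc.comp (f := fun p : (Fin d → ℝ) × (Fin d → ℝ) => (p.1, y₀ + p.2)) (by fun_prop)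
  have hHi := integ _ hHc K Q hK hQc (fun x hx z _ => h0 x hx _)
  have e : (∫ x : Fin d → ℝ, ∫ y in Q, g x y) = 
      ∫ p, g p.1 (y₀ + p.2) ∂((volume : Measure (Fin d → ℝ)).prod (volume.restrict Q)) := by
    rw [integral_prod _ hHi]
    congr 1; ext x
    exact (cube_trans (g x) (hper x) _).symm
  rw [e] at hJ
  refine absurd hJ (not_le.2 ?_)
  rw [integral_pos_iff_support_of_nonneg (fun p => hn _ _) hHi]
  have e : (volume : Measure (Fin d → ℝ)).prod (volume.restrict Q) = 
    (volume : Measure ((Fin d → ℝ) × (Fin d → ℝ))).restrict (Set.univ ×ˢ Q) := by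
    rw [Measure.volume_eq_prod, ← Measure.prod_restrict, Measure.restrict_univ]
  rw [e, Measure.restrict_apply' (MeasurableSet.univ.prod hQc.measurableSet)]
  have ho : IsOpen (Function.support (fun p : (Fin d → ℝ) × (Fin d → ℝ) => g p.1 (y₀ + p.2)) ∩ Set.univ ×ˢ interior Q) :=
    (isOpen_ne_fun hHc continuous_const).inter (isOpen_univ.prod isOpen_interior)
  refine (ho.measure_pos volume ⟨(x₀, 0), ?_, trivial, ?_⟩).trans_le (measure_mono ?_)
  · simpa using hne
  · rw [mem_interior_iff_mem_nhds]
    rw [hQ, ← Set.pi_univ_Icc]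
    exact set_pi_mem_nhds Set.finite_univ fun i _ => Icc_mem_nhds (by simpa using hpi) (by simpa using hpi)
  · exact Set.inter_subset_inter_right _ (Set.prod_mono le_rfl interior_subset)

/-- For `f : ℝ^d × ℝ^d → ℂ` continuous, compactly supported in the first
variable and `2π`-periodic in each coordinate of the second variable, for sufficiently
small `ε > 0` one has
`‖f(x, x/ε)‖_{L²_x} ≤ π^{-d/2} ‖f‖_{L²(ℝ^d × [-π,π]^d)}`. -/
theorem two_scale_conversion
    (d : ℕ) (hd : 1 ≤ d) (f : (Fin d → ℝ) → (Fin d → ℝ) → ℂ)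
    (hcont : Continuous (fun p : (Fin d → ℝ) × (Fin d → ℝ) => f p.1 p.2))
    (hsupp : ∃ K : Set (Fin d → ℝ), IsCompact K ∧ ∀ x ∉ K, ∀ y, f x y = 0)
    (hper : ∀ x y : Fin d → ℝ, ∀ k : Fin d → ℤ,
      f x (y + fun i => 2 * Real.pi * (k i : ℝ)) = f x y) :
    ∃ ε₀ > (0:ℝ), ∀ ε : ℝ, 0 < ε → ε < ε₀ →
      (∫ x : Fin d → ℝ, ‖f x (ε⁻¹ • x)‖ ^ 2) ^ ((1:ℝ)/2) ≤
        Real.pi ^ (-(d:ℝ)/2) *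
          (∫ x : Fin d → ℝ,
            ∫ y in Set.Icc (fun _ : Fin d => -Real.pi) (fun _ : Fin d => Real.pi),
              ‖f x y‖ ^ 2) ^ ((1:ℝ)/2) := by
  obtain ⟨K, hK, h0⟩ := hsupp
  have hc : Continuous (fun p : (Fin d → ℝ) × (Fin d → ℝ) => ‖f p.1 p.2‖ ^ 2) := hcont.norm.pow 2
  have h0' : ∀ x ∉ K, ∀ y, ‖f x y‖ ^ 2 = 0 := fun x hx y => by simp [h0 x hx y]
  have hper' : ∀ x y : Fin d → ℝ, ∀ k : Fin d → ℤ,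
      ‖f x (y + fun i => 2 * Real.pi * (k i : ℝ))‖ ^ 2 = ‖f x y‖ ^ 2 := fun x y k => by rw [hper]
  have hzero := zero_case (fun x y => ‖f x y‖ ^ 2) hc K hK h0' hper' (fun _ _ => by positivity)
  have happ := approx (fun x y => ‖f x y‖ ^ 2) hc K hK h0' hper'
  simp only at hzero happ
  set J := (∫ x : Fin d → ℝ,
            ∫ y in Set.Icc (fun _ : Fin d => -Real.pi) (fun _ : Fin d => Real.pi),
              ‖f x y‖ ^ 2) with hJ
  have hpi := Real.pi_pos
  rcases le_or_gt J 0 with h | h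
  · refine ⟨1, one_pos, fun ε _ _ => ?_⟩
    have hJ0 : 0 ≤ J := by positivity
    simp only [hzero h]
    simp
    positivity
  · obtain ⟨ε₀, hε₀, H⟩ := happ J h
    refine ⟨ε₀, hε₀, fun ε h1 h2 => ?_⟩
    have h3 := H ε h1 h2
    set I := ∫ x : Fin d → ℝ, ‖f x (ε⁻¹ • x)‖ ^ 2 with hI
    have hI0 : 0 ≤ I := by positivity
    have h4 : I ≤ Real.pi ^ (-(d:ℝ)) * J := by
      rw [Real.rpow_neg hpi.le, Real.rpow_natCast, inv_mul_eq_div, le_div_iff₀ (by positivity)]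
      rw [mul_pow] at h3
      have : (2:ℝ) ≤ 2 ^ d := by simpa using pow_le_pow_right₀ (one_le_two (α := ℝ)) hd
      have h5 : 0 ≤ Real.pi ^ d * I := by positivity
      nlinarith
    calc _ ≤ (Real.pi ^ (-(d:ℝ)) * J) ^ ((1:ℝ)/2) := by gcongr
      _ = _ := by
        rw [Real.mul_rpow (by positivity) h.le, ← Real.rpow_mul hpi.le]
        ring_nf
end

section
/- Define Ψ̃₀(x,y) = g(x,y) e^{iS₀(x)/ε} and Ψ*(x,y) = (2πε)^{−1/2} ∫_ℝ g(x₀,y) e^{i T₂^{x₀}[S₀](x)/ε} e^{−(x−x₀)²/(2ε)} dx₀. Then for every ε > 0: ‖Ψ* − Ψ̃₀‖ ≤ ( ‖∂_x g‖ + (5/12)^{1/2} · sup_{x∈ℝ} |S₀'''(x)| · ‖g‖ ) · ε^{1/2}. -/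
open MeasureTheory

/-- The `L²_{x,y}` norm `(∫_ℝ ∫₀^{2π} |u(x,y)|² dy dx)^{1/2}`. -/
noncomputable def L2xy (u : ℝ → ℝ → ℂ) : ℝ :=
  (∫ x : ℝ, ∫ y in Set.Icc (0:ℝ) (2 * Real.pi), ‖u x y‖ ^ 2) ^ ((1:ℝ)/2)

/-- Second order Taylor polynomial of `S₀` at `x₀`. -/
noncomputable def T2 (S₀ : ℝ → ℝ) (x₀ x : ℝ) : ℝ :=
  S₀ x₀ + deriv S₀ x₀ * (x - x₀) + (1/2) * deriv (deriv S₀) x₀ * (x - x₀)^2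


open scoped ENNReal NNReal

lemma aux_jensen {α : Type*} [MeasurableSpace α] (μ : Measure α) [IsProbabilityMeasure μ]
    (f : α → ℝ≥0∞) (hf : AEMeasurable f μ) : (∫⁻ a, f a ∂μ) ^ 2 ≤ ∫⁻ a, f a ^ 2 ∂μ := by
  have h := ENNReal.lintegral_mul_le_Lp_mul_Lq μ Real.HolderConjugate.two_two hf
    (aemeasurable_const (b := (1:ℝ≥0∞)))
  simp only [Pi.mul_apply, mul_one, ENNReal.one_rpow, one_pow, lintegral_const, measure_univ,
    ENNReal.rpow_two] at h
  calc _ ≤ ((∫⁻ a, f a ^ 2 ∂μ) ^ (1 / (2:ℝ))) ^ 2 := by gcongr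
    _ = _ := by
      rw [← ENNReal.rpow_two, ← ENNReal.rpow_mul]; norm_num

lemma aux_mink {α : Type*} [MeasurableSpace α] (μ : Measure α)
    (f g : α → ℝ≥0∞) (hf : AEMeasurable f μ) (hg : AEMeasurable g μ) :
    (∫⁻ a, (f a + g a) ^ 2 ∂μ) ^ (1 / (2:ℝ)) ≤
      (∫⁻ a, f a ^ 2 ∂μ) ^ (1 / (2:ℝ)) + (∫⁻ a, g a ^ 2 ∂μ) ^ (1 / (2:ℝ)) := by
  have h := ENNReal.lintegral_Lp_add_le hf hg (p := 2) (by norm_num)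
  simpa only [Pi.add_apply, ENNReal.rpow_two] using h

lemma aux_int_le {α : Type*} [MeasurableSpace α] (μ : Measure α) (f : α → ℝ) (hf : ∀ x, 0 ≤ f x) :
    ENNReal.ofReal (∫ a, f a ∂μ) ≤ ∫⁻ a, ENNReal.ofReal (f a) ∂μ := by
  have h := enorm_integral_le_lintegral_enorm (μ := μ) f
  rw [Real.enorm_of_nonneg (integral_nonneg hf)] at h
  refine h.trans (le_of_eq (lintegral_congr fun a => Real.enorm_of_nonneg (hf a)))

noncomputable def EE (u : ℝ → ℝ → ℂ) : ℝ≥0∞ :=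
  ∫⁻ x : ℝ, ∫⁻ y in Set.Icc (0:ℝ) (2 * Real.pi), ‖u x y‖ₑ ^ 2

lemma aux_ofReal_sq (z : ℂ) : ENNReal.ofReal (‖z‖ ^ 2) = ‖z‖ₑ ^ 2 := by
  rw [ENNReal.ofReal_pow (norm_nonneg _), ofReal_norm]

lemma ofReal_L2xy_le (u : ℝ → ℝ → ℂ) : ENNReal.ofReal (L2xy u) ≤ EE u ^ (1 / (2:ℝ)) := by
  unfold L2xy EE
  rw [← ENNReal.ofReal_rpow_of_nonneg (integral_nonneg fun x => integral_nonneg fun y => by positivity)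
    (by norm_num)]
  gcongr
  refine (aux_int_le _ _ fun x => integral_nonneg fun y => by positivity).trans ?_
  gcongr with x
  refine (aux_int_le _ _ fun y => by positivity).trans ?_
  gcongr with y
  exact (aux_ofReal_sq _).le

lemma ofReal_L2xy_eq (u : ℝ → ℝ → ℂ) (hu : Continuous (fun p : ℝ × ℝ => u p.1 p.2))
    (hK : ∃ K : Set ℝ, IsCompact K ∧ ∀ x ∉ K, ∀ y, u x y = 0) :
    ENNReal.ofReal (L2xy u) = EE u ^ (1 / (2:ℝ)) := by
  unfold L2xy EE
  rw [← ENNReal.ofReal_rpow_of_nonneg (integral_nonneg fun x => integral_nonneg fun y => by positivity)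
    (by norm_num)]
  congr 1
  have hcont : Continuous (fun x => ∫ y in Set.Icc (0:ℝ) (2 * Real.pi), ‖u x y‖ ^ 2) := by
    have := continuous_parametric_integral_of_continuous (μ := volume)
      (f := fun x y => ‖u x y‖ ^ 2) (by simp only [Function.uncurry_def]; fun_prop)
      (isCompact_Icc (a := (0:ℝ)) (b := 2 * Real.pi))
    exact this
  rw [ofReal_integral_eq_lintegral_ofReal]
  · refine lintegral_congr fun x => ?_
    rw [ofReal_integral_eq_lintegral_ofReal]
    · exact lintegral_congr fun y => aux_ofReal_sq _
    · refine Continuous.integrableOn_Icc ?_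
      have : Continuous (fun y => u x y) := hu.comp (by fun_prop : Continuous fun y : ℝ => (x, y))
      fun_prop
    · exact Filter.Eventually.of_forall fun y => by positivity
  · obtain ⟨K, hK, h0⟩ := hK
    refine hcont.integrable_of_hasCompactSupport (HasCompactSupport.intro hK fun x hx => ?_)
    simp [h0 x hx]
  · exact Filter.Eventually.of_forall fun x => integral_nonneg fun y => by positivity

lemma aux_gauss_pow (ε : ℝ) (hε : 0 < ε) (n : ℕ) (c : ℝ) (hc : Real.Gamma (n + 1/2) = c * √Real.pi) :
    ∫⁻ z, ENNReal.ofReal (z ^ (2 * n)) ∂(ProbabilityTheory.gaussianReal 0 ε.toNNReal)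
      = ENNReal.ofReal (c * (2 * ε) ^ n) := by
  have hint : Integrable (fun z : ℝ => z ^ (2 * n)) (ProbabilityTheory.gaussianReal 0 ε.toNNReal) := by
    have := (ProbabilityTheory.memLp_id_gaussianReal' (μ := 0) (v := ε.toNNReal) (2 * n : ℕ)
      (ENNReal.natCast_ne_top _)).integrable_norm_pow'
    simpa [pow_mul] using this
  rw [← ofReal_integral_eq_lintegral_ofReal hint
    (Filter.Eventually.of_forall fun z => (even_two_mul n).pow_nonneg z),
    ProbabilityTheory.integral_gaussianReal_eq_integral_smul (by simpa using hε)]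
  congr 1
  have h1 := integral_rpow_mul_exp_neg_mul_rpow (p := 2) (q := (2 * n : ℕ)) (b := 1 / (2 * ε))
    (by norm_num) (by have : (0:ℝ) ≤ (2 * n : ℕ) := by positivity
                      linarith) (by positivity)
  have h2 := integral_comp_abs (f := fun x : ℝ => x ^ (2 * n) * Real.exp (-(1 / (2 * ε)) * x ^ 2))
  simp only [Real.rpow_natCast, Real.rpow_two] at h1
  rw [h1] at h2
  simp only [(even_two_mul n).pow_abs, sq_abs] at h2
  have h3 : ∀ x : ℝ, ProbabilityTheory.gaussianPDFReal 0 ε.toNNReal x • x ^ (2 * n) =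
      (√(2 * Real.pi * ε))⁻¹ * (x ^ (2 * n) * Real.exp (-(1 / (2 * ε)) * x ^ 2)) := by
    intro x
    simp only [ProbabilityTheory.gaussianPDFReal, Real.coe_toNNReal _ hε.le, smul_eq_mul, sub_zero]
    rw [show -x ^ 2 / (2 * ε) = -(1 / (2 * ε)) * x ^ 2 by ring]; ring
  simp only [h3]
  rw [integral_const_mul, h2]
  have e1 : (((2 * n : ℕ) : ℝ) + 1) / 2 = n + 1 / 2 := by push_cast; ring
  rw [neg_div, e1, hc, one_div (2 * ε), Real.inv_rpow (by positivity), ← Real.rpow_neg (by positivity), neg_neg,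
    Real.rpow_add (by positivity), Real.rpow_natCast, ← Real.sqrt_eq_rpow]
  rw [show 2 * Real.pi * ε = Real.pi * (2 * ε) by ring, Real.sqrt_mul (by positivity)]
  have : √Real.pi ≠ 0 := by positivity
  have : √(2 * ε) ≠ 0 := by positivity
  field_simp

lemma aux_gauss2 (ε : ℝ) (hε : 0 < ε) :
    ∫⁻ z, ENNReal.ofReal (z ^ 2) ∂(ProbabilityTheory.gaussianReal 0 ε.toNNReal)
      = ENNReal.ofReal ε := by
  have h := aux_gauss_pow ε hε 1 (1/2) (by
    rw [Nat.cast_one, add_comm, Real.Gamma_add_one (by norm_num), Real.Gamma_one_half_eq])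
  rw [show 1 / 2 * (2 * ε) ^ 1 = ε by ring] at h
  simpa using h

lemma aux_gauss6 (ε : ℝ) (hε : 0 < ε) :
    ∫⁻ z, ENNReal.ofReal (z ^ 6) ∂(ProbabilityTheory.gaussianReal 0 ε.toNNReal)
      = ENNReal.ofReal (15 * ε ^ 3) := by
  have h := aux_gauss_pow ε hε 3 (15/8) (by
    rw [show ((3:ℕ):ℝ) + 1/2 = 1/2 + 1 + 1 + 1 by norm_num, Real.Gamma_add_one (by norm_num),
      Real.Gamma_add_one (by norm_num), Real.Gamma_add_one (by norm_num), Real.Gamma_one_half_eq]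
    ring)
  rw [show 15 / 8 * (2 * ε) ^ 3 = 15 * ε ^ 3 by ring] at h
  simpa using h

lemma aux_taylor (S₀ : ℝ → ℝ) (hS : ContDiff ℝ 3 S₀) (M : ℝ)
    (hM : ∀ x, |iteratedDeriv 3 S₀ x| ≤ M) (x₀ x : ℝ) :
    |T2 S₀ x₀ x - S₀ x| ≤ M / 6 * |x - x₀| ^ 3 := by
  rcases eq_or_ne x₀ x with rfl | hx
  · simp [T2]
  obtain ⟨t, -, ht⟩ := taylor_mean_remainder_lagrange_iteratedDeriv (n := 2) hx
    (hS.contDiffOn.of_le (by norm_num))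
  have hu : UniqueDiffOn ℝ (Set.uIcc x₀ x) := uniqueDiffOn_uIcc hx
  have hmem : x₀ ∈ Set.uIcc x₀ x := Set.left_mem_uIcc
  have hT : taylorWithinEval S₀ 2 (Set.uIcc x₀ x) x₀ x = T2 S₀ x₀ x := by
    rw [taylorWithinEval_succ, taylorWithinEval_succ, taylor_within_zero_eval,
      iteratedDerivWithin_eq_iteratedDeriv hu (hS.of_le (by norm_num)).contDiffAt hmem,
      iteratedDerivWithin_eq_iteratedDeriv hu (hS.of_le (by norm_num)).contDiffAt hmem]
    simp only [zero_add, iteratedDeriv_succ, T2, smul_eq_mul, iteratedDeriv_zero]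
    norm_num
    ring
  rw [hT] at ht
  rw [abs_sub_comm, ht, abs_div, abs_mul, abs_pow]
  norm_num [Nat.factorial]
  have := mul_le_mul_of_nonneg_right (hM t) (by positivity : 0 ≤ |x - x₀| ^ 3)
  linarith

lemma aux_swap3 (μ ν γ : Measure ℝ) [SFinite μ] [SFinite ν] [SFinite γ] (F : ℝ → ℝ → ℝ → ℝ≥0∞)
    (hF : Measurable (fun p : ℝ × ℝ × ℝ => F p.1 p.2.1 p.2.2)) :
    ∫⁻ x, ∫⁻ y, ∫⁻ z, F x y z ∂γ ∂ν ∂μ = ∫⁻ z, ∫⁻ x, ∫⁻ y, F x y z ∂ν ∂μ ∂γ := by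
  have h1 : ∀ x, ∫⁻ y, ∫⁻ z, F x y z ∂γ ∂ν = ∫⁻ z, ∫⁻ y, F x y z ∂ν ∂γ := fun x => by
    refine lintegral_lintegral_swap (Measurable.aemeasurable ?_)
    exact hF.comp (by fun_prop : Measurable fun p : ℝ × ℝ => (x, p.1, p.2))
  simp only [h1]
  refine lintegral_lintegral_swap (Measurable.aemeasurable ?_)
  have : Measurable (fun q : (ℝ × ℝ) × ℝ => F q.1.1 q.2 q.1.2) :=
    hF.comp (by fun_prop : Measurable fun q : (ℝ × ℝ) × ℝ => (q.1.1, q.2, q.1.2))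
  exact this.lintegral_prod_right'

lemma EE_shift (u : ℝ → ℝ → ℂ) (s : ℝ) : EE (fun x y => u (x - s) y) = EE u := by
  unfold EE
  exact lintegral_sub_right_eq_self
    (fun x => ∫⁻ y in Set.Icc (0:ℝ) (2 * Real.pi), ‖u x y‖ₑ ^ 2) s

lemma EE_diff (g g' : ℝ → ℝ → ℂ) (hc : Continuous (fun p : ℝ × ℝ => g' p.1 p.2))
    (hd : ∀ x y, HasDerivAt (fun x' => g x' y) (g' x y) x) (z : ℝ) :
    EE (fun x y => g (x - z) y - g x y) ≤ ENNReal.ofReal (z ^ 2) * EE g' := by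
  have : IsProbabilityMeasure (volume.restrict (Set.Ioc (0:ℝ) 1)) := ⟨by simp⟩
  have hpt : ∀ x y, ‖g (x - z) y - g x y‖ₑ ^ 2 ≤
      ∫⁻ t in Set.Ioc (0:ℝ) 1, ENNReal.ofReal (z ^ 2) * ‖g' (x - t * z) y‖ₑ ^ 2 := by
    intro x y
    have hcy : Continuous (fun t : ℝ => g' (x - t * z) y) :=
      hc.comp (by fun_prop : Continuous fun t : ℝ => (x - t * z, y))
    have h1 : ∫ t in (0:ℝ)..1, (-z) • g' (x - t * z) y = g (x - z) y - g x y := by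
      have := intervalIntegral.integral_eq_sub_of_hasDerivAt (a := (0:ℝ)) (b := 1)
        (f := fun t => g (x - t * z) y) (f' := fun t => (-z) • g' (x - t * z) y)
        (fun t _ => by
          have hi : HasDerivAt (fun t : ℝ => x - t * z) (-z) t := by
            simpa using ((hasDerivAt_id t).mul_const z).const_sub x
          exact (hd (x - t * z) y).scomp t hi)
        ((by fun_prop : Continuous fun t => (-z) • g' (x - t * z) y).intervalIntegrable _ _)
      simpa using this
    rw [← h1, intervalIntegral.integral_of_le zero_le_one]
    calc _ ≤ (∫⁻ t in Set.Ioc (0:ℝ) 1, ‖(-z) • g' (x - t * z) y‖ₑ) ^ 2 := by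
          gcongr; exact enorm_integral_le_lintegral_enorm _
      _ ≤ ∫⁻ t in Set.Ioc (0:ℝ) 1, ‖(-z) • g' (x - t * z) y‖ₑ ^ 2 :=
          aux_jensen _ _ (by fun_prop)
      _ = _ := by
          refine lintegral_congr fun t => ?_
          rw [enorm_smul, mul_pow, enorm_neg, ← sq_abs z, ENNReal.ofReal_pow (abs_nonneg _),
            ← Real.norm_eq_abs, ofReal_norm]
  calc EE (fun x y => g (x - z) y - g x y)
      ≤ ∫⁻ x : ℝ, ∫⁻ y in Set.Icc (0:ℝ) (2 * Real.pi), ∫⁻ t in Set.Ioc (0:ℝ) 1,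
          ENNReal.ofReal (z ^ 2) * ‖g' (x - t * z) y‖ₑ ^ 2 := by
        unfold EE
        gcongr with x y
        exact hpt x y
    _ = ∫⁻ t in Set.Ioc (0:ℝ) 1, ∫⁻ x : ℝ, ∫⁻ y in Set.Icc (0:ℝ) (2 * Real.pi),
          ENNReal.ofReal (z ^ 2) * ‖g' (x - t * z) y‖ₑ ^ 2 := by
        refine aux_swap3 _ _ _ _ ?_
        have : Continuous (fun p : ℝ × ℝ × ℝ => g' (p.1 - p.2.2 * z) p.2.1) :=
          hc.comp (by fun_prop : Continuous fun p : ℝ × ℝ × ℝ => (p.1 - p.2.2 * z, p.2.1))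
        exact (this.measurable.enorm.pow_const 2).const_mul _
    _ = ∫⁻ t in Set.Ioc (0:ℝ) 1, ENNReal.ofReal (z ^ 2) * EE g' := by
        refine lintegral_congr fun t => ?_
        rw [← EE_shift g' (t * z)]
        unfold EE
        simp only [lintegral_const_mul' _ _ ENNReal.ofReal_ne_top]
    _ = _ := by simp

lemma aux_pt (ε : ℝ) (hε : 0 < ε) (S₀ : ℝ → ℝ) (hS : ContDiff ℝ 3 S₀) (M : ℝ)
    (hM : ∀ x, |iteratedDeriv 3 S₀ x| ≤ M)
    (g : ℝ → ℝ → ℂ) (hg : Continuous (fun p : ℝ × ℝ => g p.1 p.2))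
    (hgsupp : ∃ K : Set ℝ, IsCompact K ∧ ∀ x ∉ K, ∀ y, g x y = 0) (x y : ℝ) :
    ‖(((2 * Real.pi * ε) ^ (-(1:ℝ)/2) : ℝ) : ℂ) *
          (∫ x₀ : ℝ, g x₀ y * Complex.exp (Complex.I * (T2 S₀ x₀ x : ℝ) / (ε:ℂ)) *
            Complex.exp (-(((x - x₀)^2 : ℝ) : ℂ) / (2 * (ε:ℂ))))
        - g x y * Complex.exp (Complex.I * (S₀ x : ℝ) / (ε:ℂ))‖ₑ ≤
    ∫⁻ z, (ENNReal.ofReal (M / (6 * ε) * |z| ^ 3) * ‖g (x - z) y‖ₑ + ‖g (x - z) y - g x y‖ₑ)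
      ∂(ProbabilityTheory.gaussianReal 0 ε.toNNReal) := by
  set γ := ProbabilityTheory.gaussianReal 0 ε.toNNReal with hγ
  have hεc : (ε : ℂ) ≠ 0 := by exact_mod_cast hε.ne'
  have hgy : Continuous (fun x => g x y) := hg.comp (by fun_prop : Continuous fun x : ℝ => (x, y))
  have hS1 : Continuous (deriv S₀) := hS.continuous_deriv (by norm_num)
  have hS2 : Continuous (deriv (deriv S₀)) := by
    have := hS.continuous_iteratedDeriv 2 (by norm_num)
    simpa [iteratedDeriv_succ] using this
  have hS0 : Continuous S₀ := hS.continuous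
  have hexp : ∀ r : ℝ, Complex.exp (Complex.I * (r:ℂ) / (ε:ℂ)) = Complex.exp (Complex.I * ((r / ε : ℝ) : ℂ)) := by
    intro r; push_cast; rw [mul_div_assoc]
  have hnorm : ∀ r : ℝ, ‖Complex.exp (Complex.I * (r:ℂ) / (ε:ℂ))‖ = 1 := by
    intro r; rw [hexp, mul_comm, Complex.norm_exp_ofReal_mul_I]
  have h1 : (((2 * Real.pi * ε) ^ (-(1:ℝ)/2) : ℝ) : ℂ) *
          (∫ x₀ : ℝ, g x₀ y * Complex.exp (Complex.I * (T2 S₀ x₀ x : ℝ) / (ε:ℂ)) *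
            Complex.exp (-(((x - x₀)^2 : ℝ) : ℂ) / (2 * (ε:ℂ)))) =
      ∫ z, g (x - z) y * Complex.exp (Complex.I * (T2 S₀ (x - z) x : ℝ) / (ε:ℂ)) ∂γ := by
    rw [hγ, ProbabilityTheory.integral_gaussianReal_eq_integral_smul (by simpa using hε),
      ← integral_const_mul, ← integral_sub_left_eq_self _ _ x]
    refine integral_congr_ae (Filter.Eventually.of_forall fun z => ?_)
    simp only [ProbabilityTheory.gaussianPDFReal, Real.coe_toNNReal _ hε.le, sub_zero, sub_sub_cancel,
      Complex.real_smul]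
    rw [show -(1:ℝ)/2 = -(1/2) by ring, Real.rpow_neg (by positivity), ← Real.sqrt_eq_rpow]
    push_cast
    ring
  have hbd : ∃ C, ∀ x, ‖g x y‖ ≤ C := by
    obtain ⟨K, hK, h0⟩ := hgsupp
    exact hgy.bounded_above_of_compact_support (HasCompactSupport.intro hK fun x hx => h0 x hx y)
  obtain ⟨C, hC⟩ := hbd
  have hint : Integrable (fun z => g (x - z) y *
      Complex.exp (Complex.I * (T2 S₀ (x - z) x : ℝ) / (ε:ℂ))) γ := by
    refine Integrable.of_bound (Continuous.aestronglyMeasurable ?_) C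
      (Filter.Eventually.of_forall fun z => ?_)
    · unfold T2
      fun_prop
    · rw [norm_mul, hnorm, mul_one]; exact hC _
  have h2 : g x y * Complex.exp (Complex.I * (S₀ x : ℝ) / (ε:ℂ)) =
      ∫ z, g x y * Complex.exp (Complex.I * (S₀ x : ℝ) / (ε:ℂ)) ∂γ := by simp
  rw [h1, h2, ← integral_sub hint (integrable_const _)]
  refine (enorm_integral_le_lintegral_enorm _).trans ?_
  gcongr with z
  rw [← ofReal_norm, ← ofReal_norm, ← ofReal_norm (g (x - z) y - g x y), ← ENNReal.ofReal_mul',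
    ← ENNReal.ofReal_add]
  rotate_left
  · have : 0 ≤ M := (abs_nonneg _).trans (hM 0)
    positivity
  · positivity
  · positivity
  refine ENNReal.ofReal_le_ofReal ?_
  set A := Complex.exp (Complex.I * (T2 S₀ (x - z) x : ℝ) / (ε:ℂ)) with hA
  set B := Complex.exp (Complex.I * (S₀ x : ℝ) / (ε:ℂ)) with hB
  have hAB : ‖A - B‖ ≤ M / (6 * ε) * |z| ^ 3 := by
    have e : A - B = B * (Complex.exp (Complex.I * (((T2 S₀ (x - z) x - S₀ x) / ε : ℝ) : ℂ)) - 1) := by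
      rw [mul_sub, mul_one, hB, ← Complex.exp_add, hA]
      congr 2
      push_cast
      field_simp
      ring
    rw [e, norm_mul, hnorm, one_mul]
    refine (Real.norm_exp_I_mul_ofReal_sub_one_le).trans ?_
    rw [Real.norm_eq_abs, abs_div, abs_of_pos hε, div_le_iff₀ hε]
    have := aux_taylor S₀ hS M hM (x - z) x
    rw [sub_sub_cancel] at this
    refine this.trans (le_of_eq ?_)
    field_simp
  calc ‖g (x - z) y * A - g x y * B‖ = ‖(A - B) * g (x - z) y + (g (x - z) y - g x y) * B‖ := by
        congr 1; ring
    _ ≤ ‖A - B‖ * ‖g (x - z) y‖ + ‖g (x - z) y - g x y‖ * ‖B‖ := by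
        refine (norm_add_le _ _).trans ?_
        rw [norm_mul, norm_mul]
    _ ≤ _ := by
        rw [hnorm, mul_one]; gcongr

/-- With `Ψ̃₀(x,y) = g(x,y) e^{iS₀(x)/ε}` and
`Ψ*(x,y) = (2πε)^{-1/2} ∫ g(x₀,y) e^{iT₂^{x₀}[S₀](x)/ε} e^{-(x-x₀)²/(2ε)} dx₀`, one has
`‖Ψ* − Ψ̃₀‖ ≤ (‖∂_x g‖ + √(5/12)·sup|S₀'''|·‖g‖) ε^{1/2}`. -/
theorem initial_error_lemma41
    (ε : ℝ) (hε : 0 < ε)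
    (S₀ : ℝ → ℝ) (hS : ContDiff ℝ 3 S₀)
    (hSb : ∀ i ≤ 3, ∃ C : ℝ, ∀ x, |iteratedDeriv i S₀ x| ≤ C)
    (g : ℝ → ℝ → ℂ) (hg : ContDiff ℝ 1 (fun p : ℝ × ℝ => g p.1 p.2))
    (hgsupp : ∃ K : Set ℝ, IsCompact K ∧ ∀ x ∉ K, ∀ y, g x y = 0)
    (hgper : ∀ x y, g x (y + 2 * Real.pi) = g x y) :
    L2xy (fun x y =>
        (((2 * Real.pi * ε) ^ (-(1:ℝ)/2) : ℝ) : ℂ) *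
          (∫ x₀ : ℝ, g x₀ y * Complex.exp (Complex.I * (T2 S₀ x₀ x : ℝ) / (ε:ℂ)) *
            Complex.exp (-(((x - x₀)^2 : ℝ) : ℂ) / (2 * (ε:ℂ))))
        - g x y * Complex.exp (Complex.I * (S₀ x : ℝ) / (ε:ℂ))) ≤
      (L2xy (fun x y => deriv (fun x' => g x' y) x)
        + Real.sqrt (5/12) * (⨆ x : ℝ, |iteratedDeriv 3 S₀ x|) * L2xy g) * ε ^ ((1:ℝ)/2) := by
  set M := ⨆ x : ℝ, |iteratedDeriv 3 S₀ x| with hMdef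
  have hM : ∀ x, |iteratedDeriv 3 S₀ x| ≤ M := by
    obtain ⟨C, hC⟩ := hSb 3 le_rfl
    exact fun x => le_ciSup (f := fun x => |iteratedDeriv 3 S₀ x|)
      ⟨C, by rintro _ ⟨x, rfl⟩; exact hC x⟩ x
  have hM0 : 0 ≤ M := (abs_nonneg _).trans (hM 0)
  have hgc : Continuous (fun p : ℝ × ℝ => g p.1 p.2) := hg.continuous
  set g' : ℝ → ℝ → ℂ := fun x y => deriv (fun x' => g x' y) x with hg'
  have hd0 : ∀ x y, HasDerivAt (fun x' => g x' y)
      (fderiv ℝ (fun p : ℝ × ℝ => g p.1 p.2) (x, y) (1, 0)) x := by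
    intro x y
    have h1 : HasFDerivAt (fun p : ℝ × ℝ => g p.1 p.2) _ (x, y) :=
      ((hg.differentiable (by norm_num)) (x, y)).hasFDerivAt
    exact h1.comp_hasDerivAt x ((hasDerivAt_id x).prodMk (hasDerivAt_const x y))
  have hd : ∀ x y, HasDerivAt (fun x' => g x' y) (g' x y) x := fun x y =>
    (hd0 x y).differentiableAt.hasDerivAt
  have hg'c : Continuous (fun p : ℝ × ℝ => g' p.1 p.2) := by
    have : (fun p : ℝ × ℝ => g' p.1 p.2) =
        fun p => fderiv ℝ (fun p : ℝ × ℝ => g p.1 p.2) p (1, 0) := by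
      funext p; exact (hd0 p.1 p.2).deriv
    rw [this]
    exact (hg.continuous_fderiv (by norm_num)).clm_apply continuous_const
  have hg'supp : ∃ K : Set ℝ, IsCompact K ∧ ∀ x ∉ K, ∀ y, g' x y = 0 := by
    obtain ⟨K, hK, h0⟩ := hgsupp
    refine ⟨K, hK, fun x hx y => ?_⟩
    have : (fun x' => g x' y) =ᶠ[nhds x] fun _ => 0 := by
      filter_upwards [hK.isClosed.isOpen_compl.mem_nhds hx] with t ht using h0 t ht y
    simp only [hg', this.deriv_eq, deriv_const]
  have hL0 : ∀ u, 0 ≤ L2xy u := fun u =>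
    Real.rpow_nonneg (integral_nonneg fun x => integral_nonneg fun y => by positivity) _
  have hRHS : 0 ≤ (L2xy g' + √(5/12) * M * L2xy g) * ε ^ ((1:ℝ)/2) := by
    have := hL0 g'; have := hL0 g; positivity
  rw [← ENNReal.ofReal_le_ofReal_iff hRHS]
  refine (ofReal_L2xy_le _).trans ?_
  set γ := ProbabilityTheory.gaussianReal 0 ε.toNNReal with hγ
  set ν := volume.restrict (Set.Icc (0:ℝ) (2 * Real.pi)) with hν
  set a : ℝ → ℝ → ℝ → ℝ≥0∞ := fun x y z =>
    ENNReal.ofReal (M / (6 * ε) * |z| ^ 3) * ‖g (x - z) y‖ₑ with ha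
  set b : ℝ → ℝ → ℝ → ℝ≥0∞ := fun x y z => ‖g (x - z) y - g x y‖ₑ with hb
  have hc1 : Continuous (fun p : ℝ × ℝ × ℝ => g (p.1 - p.2.2) p.2.1) :=
    hgc.comp (by fun_prop : Continuous fun p : ℝ × ℝ × ℝ => (p.1 - p.2.2, p.2.1))
  have hc2 : Continuous (fun p : ℝ × ℝ × ℝ => g p.1 p.2.1) :=
    hgc.comp (by fun_prop : Continuous fun p : ℝ × ℝ × ℝ => (p.1, p.2.1))
  have hma : Measurable (fun p : ℝ × ℝ × ℝ => a p.1 p.2.1 p.2.2) := by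
    simp only [ha]
    exact (by fun_prop : Measurable fun p : ℝ × ℝ × ℝ =>
      ENNReal.ofReal (M / (6 * ε) * |p.2.2| ^ 3)).mul hc1.measurable.enorm
  have hmb : Measurable (fun p : ℝ × ℝ × ℝ => b p.1 p.2.1 p.2.2) := by
    exact (hc1.sub hc2).measurable.enorm
  have hprod : ∀ F : ℝ → ℝ → ℝ → ℝ≥0∞, Measurable (fun p : ℝ × ℝ × ℝ => F p.1 p.2.1 p.2.2) →
      ∫⁻ p, F p.1 p.2.1 p.2.2 ∂((volume : Measure ℝ).prod (ν.prod γ)) =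
      ∫⁻ x, ∫⁻ y, ∫⁻ z, F x y z ∂γ ∂ν := by
    intro F hF
    rw [lintegral_prod _ hF.aemeasurable]
    refine lintegral_congr fun x => ?_
    rw [lintegral_prod]
    exact (hF.comp (by fun_prop : Measurable fun p : ℝ × ℝ => (x, p.1, p.2))).aemeasurable
  have hE : EE (fun x y =>
        (((2 * Real.pi * ε) ^ (-(1:ℝ)/2) : ℝ) : ℂ) *
          (∫ x₀ : ℝ, g x₀ y * Complex.exp (Complex.I * (T2 S₀ x₀ x : ℝ) / (ε:ℂ)) *
            Complex.exp (-(((x - x₀)^2 : ℝ) : ℂ) / (2 * (ε:ℂ))))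
        - g x y * Complex.exp (Complex.I * (S₀ x : ℝ) / (ε:ℂ))) ≤
      ∫⁻ p : ℝ × ℝ × ℝ, (a p.1 p.2.1 p.2.2 + b p.1 p.2.1 p.2.2) ^ 2
        ∂((volume : Measure ℝ).prod (ν.prod γ)) := by
    rw [hprod (fun x y z => (a x y z + b x y z) ^ 2) ((hma.add hmb).pow_const 2)]
    unfold EE
    gcongr with x y
    calc _ ≤ (∫⁻ z, (a x y z + b x y z) ∂γ) ^ 2 := by
          gcongr
          exact aux_pt ε hε S₀ hS M hM g hgc hgsupp x y
      _ ≤ _ := aux_jensen _ _ ((hma.add hmb).comp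
          (by fun_prop : Measurable fun z : ℝ => (x, y, z))).aemeasurable
  have hEa : ∫⁻ p : ℝ × ℝ × ℝ, (a p.1 p.2.1 p.2.2) ^ 2 ∂((volume : Measure ℝ).prod (ν.prod γ)) =
      ENNReal.ofReal (5 / 12 * M ^ 2 * ε) * EE g := by
    rw [hprod (fun x y z => (a x y z) ^ 2) (hma.pow_const 2), aux_swap3 _ _ _ _ (hma.pow_const 2)]
    have : ∀ z, ∫⁻ x, ∫⁻ y, (a x y z) ^ 2 ∂ν =
        (ENNReal.ofReal ((M / (6 * ε)) ^ 2) * ENNReal.ofReal (z ^ 6)) * EE g := by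
      intro z
      rw [← EE_shift g z]
      unfold EE
      have e : ENNReal.ofReal ((M / (6 * ε)) ^ 2) * ENNReal.ofReal (z ^ 6) =
          ENNReal.ofReal (M / (6 * ε) * |z| ^ 3) ^ 2 := by
        rw [← ENNReal.ofReal_mul (by positivity), ← ENNReal.ofReal_pow (by positivity)]
        congr 1
        rw [mul_pow, ← pow_mul, (show Even (3 * 2) by decide).pow_abs]
      rw [e]
      simp only [ha, mul_pow]
      have hne : ENNReal.ofReal (M / (6 * ε) * |z| ^ 3) ^ 2 ≠ ⊤ := by simp
      simp only [lintegral_const_mul' _ _ hne, hν]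
    simp only [this]
    rw [lintegral_mul_const _ (by fun_prop), lintegral_const_mul _ (by fun_prop),
      aux_gauss6 ε hε, ← ENNReal.ofReal_mul (by positivity)]
    congr 2
    field_simp
    ring
  have hEb : ∫⁻ p : ℝ × ℝ × ℝ, (b p.1 p.2.1 p.2.2) ^ 2 ∂((volume : Measure ℝ).prod (ν.prod γ)) ≤
      ENNReal.ofReal ε * EE g' := by
    rw [hprod (fun x y z => (b x y z) ^ 2) (hmb.pow_const 2), aux_swap3 _ _ _ _ (hmb.pow_const 2)]
    calc _ ≤ ∫⁻ z, ENNReal.ofReal (z ^ 2) * EE g' ∂γ :=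
          lintegral_mono fun z => EE_diff g g' hg'c hd z
      _ = _ := by rw [lintegral_mul_const _ (by fun_prop), aux_gauss2 ε hε]
  have hh : (0:ℝ) ≤ 1 / 2 := by norm_num
  calc _ ≤ (∫⁻ p : ℝ × ℝ × ℝ, (a p.1 p.2.1 p.2.2 + b p.1 p.2.1 p.2.2) ^ 2
        ∂((volume : Measure ℝ).prod (ν.prod γ))) ^ (1 / (2:ℝ)) := by gcongr
    _ ≤ _ := aux_mink _ _ _ hma.aemeasurable hmb.aemeasurable
    _ ≤ (ENNReal.ofReal (5 / 12 * M ^ 2 * ε) * EE g) ^ (1 / (2:ℝ)) +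
        (ENNReal.ofReal ε * EE g') ^ (1 / (2:ℝ)) := by rw [hEa]; gcongr
    _ = ENNReal.ofReal ((√(5/12) * M * ε ^ ((1:ℝ)/2)) * L2xy g) +
        ENNReal.ofReal (ε ^ ((1:ℝ)/2) * L2xy g') := by
      rw [ENNReal.mul_rpow_of_nonneg _ _ hh, ENNReal.mul_rpow_of_nonneg _ _ hh,
        ← ofReal_L2xy_eq g hgc hgsupp, ← ofReal_L2xy_eq g' hg'c hg'supp,
        ENNReal.ofReal_rpow_of_nonneg (by positivity) hh,
        ENNReal.ofReal_rpow_of_nonneg hε.le hh, ← ENNReal.ofReal_mul (by positivity),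
        ← ENNReal.ofReal_mul (by positivity)]
      congr 3
      rw [← Real.sqrt_eq_rpow, ← Real.sqrt_eq_rpow, Real.sqrt_mul (by positivity),
        Real.sqrt_mul (by positivity), Real.sqrt_sq hM0]
    _ = _ := by
      rw [← ENNReal.ofReal_add (mul_nonneg (by positivity) (hL0 g))
        (mul_nonneg (by positivity) (hL0 g'))]
      congr 1
      ring
end

section
/- Define I(x,y) = (2πε)^{−1/2} ∫_ℝ ( g(x₀,y) − g(x,y) ) e^{i T₂^{x₀}[S₀](x)/ε} e^{−(x−x₀)²/(2ε)} dx₀. Then for every ε > 0: ‖I‖² ≤ ε ‖∂_x g‖². -/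
open MeasureTheory

open ProbabilityTheory in
lemma aux_sq {α : Type*} [MeasurableSpace α] (μ : Measure α) [IsProbabilityMeasure μ]
    (f : α → ENNReal) (hf : AEMeasurable f μ) : (∫⁻ a, f a ∂μ) ^ 2 ≤ ∫⁻ a, f a ^ 2 ∂μ := by
  have h := ENNReal.lintegral_mul_le_Lp_mul_Lq μ Real.HolderConjugate.two_two hf
    (aemeasurable_const (b := (1 : ENNReal)))
  simp only [Pi.mul_apply, mul_one, ENNReal.one_rpow, lintegral_const, measure_univ] at h
  calc _ ≤ ((∫⁻ a, f a ^ (2:ℝ) ∂μ) ^ (1 / (2:ℝ))) ^ 2 := by gcongr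
    _ = _ := by
      rw [← ENNReal.rpow_natCast, ← ENNReal.rpow_mul]
      norm_num

lemma aux_L2 (u : ℝ → ℝ → ℂ) :
    L2xy u ^ 2 = ∫ x : ℝ, ∫ y in Set.Icc (0:ℝ) (2 * Real.pi), ‖u x y‖ ^ 2 := by
  unfold L2xy
  rw [← Real.rpow_natCast, ← Real.rpow_mul]
  · norm_num
  · exact integral_nonneg fun x => integral_nonneg fun y => by positivity

lemma aux_le (u : ℝ → ℝ → ℂ) :
    ENNReal.ofReal (L2xy u ^ 2) ≤
      ∫⁻ x : ℝ, ∫⁻ y in Set.Icc (0:ℝ) (2 * Real.pi), ‖u x y‖ₑ ^ 2 := by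
  rw [aux_L2, ← Real.enorm_of_nonneg
    (integral_nonneg fun x => integral_nonneg fun y => by positivity)]
  refine (enorm_integral_le_lintegral_enorm _).trans (lintegral_mono fun x => ?_)
  refine (enorm_integral_le_lintegral_enorm _).trans (lintegral_mono fun y => ?_)
  simp

lemma aux_eq (u : ℝ → ℝ → ℂ) (hu : Continuous (fun p : ℝ × ℝ => u p.1 p.2))
    (K : Set ℝ) (hK : IsCompact K) (h0 : ∀ x ∉ K, ∀ y, u x y = 0) :
    ENNReal.ofReal (L2xy u ^ 2) =
      ∫⁻ x : ℝ, ∫⁻ y in Set.Icc (0:ℝ) (2 * Real.pi), ‖u x y‖ₑ ^ 2 := by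
  have hc : Continuous (fun p : ℝ × ℝ => ‖u p.1 p.2‖ ^ 2) := by fun_prop
  have hi : Integrable (fun p : ℝ × ℝ => ‖u p.1 p.2‖ ^ 2)
      ((volume : Measure ℝ).prod (volume.restrict (Set.Icc (0:ℝ) (2 * Real.pi)))) := by
    have h1 : IntegrableOn (fun p : ℝ × ℝ => ‖u p.1 p.2‖ ^ 2)
        (K ×ˢ Set.Icc (0:ℝ) (2 * Real.pi)) volume :=
      hc.continuousOn.integrableOn_compact (hK.prod isCompact_Icc)
    have h2 : IntegrableOn (fun p : ℝ × ℝ => ‖u p.1 p.2‖ ^ 2)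
        (Set.univ ×ˢ Set.Icc (0:ℝ) (2 * Real.pi)) volume := by
      refine h1.of_forall_sdiff_eq_zero (MeasurableSet.univ.prod measurableSet_Icc) ?_
      rintro ⟨x, y⟩ ⟨⟨_, hy⟩, hn⟩
      have : x ∉ K := fun hx => hn ⟨hx, hy⟩
      simp [h0 x this y]
    rw [IntegrableOn, Measure.volume_eq_prod, ← Measure.prod_restrict, Measure.restrict_univ] at h2
    exact h2
  rw [aux_L2, ofReal_integral_eq_lintegral_ofReal hi.integral_prod_left
    (Filter.Eventually.of_forall fun x => integral_nonneg fun y => by positivity)]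
  refine lintegral_congr fun x => ?_
  rw [ofReal_integral_eq_lintegral_ofReal _
    (Filter.Eventually.of_forall fun y => by positivity)]
  · refine lintegral_congr fun y => ?_
    rw [ENNReal.ofReal_pow (norm_nonneg _), ofReal_norm]
  · have : Continuous (fun y => ‖u x y‖ ^ 2) := hc.comp (by fun_prop : Continuous fun y => (x, y))
    exact this.continuousOn.integrableOn_compact isCompact_Icc

open ProbabilityTheory in
lemma aux_gauss (v : NNReal) : ∫⁻ h : ℝ, ‖h‖ₑ ^ 2 ∂(gaussianReal 0 v) = ENNReal.ofReal v := by
  have h := evariance_def' (μ := gaussianReal 0 v) (X := fun x : ℝ => x) (by fun_prop)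
  rw [← ofReal_variance (X := fun x : ℝ => x) (memLp_id_gaussianReal' (μ := 0) (v := v) 2 (by simp)),
    variance_fun_id_gaussianReal, integral_id_gaussianReal] at h
  simpa using h.symm

lemma aux_ftc (f f' : ℝ → ℂ) (hf : ∀ x, HasDerivAt f (f' x) x) (hc : Continuous f') (x h : ℝ) :
    ‖f (x + h) - f x‖ₑ ^ 2 ≤
      ∫⁻ t in Set.Ioc (0:ℝ) 1, ‖h‖ₑ ^ 2 * ‖f' (x + t * h)‖ₑ ^ 2 := by
  have hd : ∀ t ∈ Set.uIcc (0:ℝ) 1,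
      HasDerivAt (fun t : ℝ => f (x + t * h)) (h • f' (x + t * h)) t := by
    intro t _
    have h1 : HasDerivAt (fun t : ℝ => x + t * h) h t := by
      simpa using ((hasDerivAt_id t).mul_const h).const_add x
    exact (hf (x + t * h)).scomp t h1
  have e := intervalIntegral.integral_eq_sub_of_hasDerivAt hd
    (Continuous.intervalIntegrable (by fun_prop) _ _)
  simp only [one_mul, zero_mul, add_zero] at e
  rw [← e, intervalIntegral.integral_of_le zero_le_one]
  have : IsProbabilityMeasure (volume.restrict (Set.Ioc (0:ℝ) 1)) := ⟨by simp⟩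
  calc _ ≤ (∫⁻ t in Set.Ioc (0:ℝ) 1, ‖h • f' (x + t * h)‖ₑ) ^ 2 := by
        gcongr; exact enorm_integral_le_lintegral_enorm _
    _ ≤ ∫⁻ t in Set.Ioc (0:ℝ) 1, ‖h • f' (x + t * h)‖ₑ ^ 2 :=
        aux_sq _ _ (by fun_prop)
    _ = _ := by simp only [enorm_smul, mul_pow]

open ProbabilityTheory in
lemma aux_point (ε : ℝ) (hε : 0 < ε) (T : ℝ → ℝ) (f : ℝ → ℂ) (hf : Continuous f) (x : ℝ) :
    ‖(((2 * Real.pi * ε) ^ (-(1:ℝ)/2) : ℝ) : ℂ) *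
          ∫ x₀ : ℝ, (f x₀ - f x) * Complex.exp (Complex.I * (T x₀ : ℝ) / (ε:ℂ)) *
            Complex.exp (-(((x - x₀)^2 : ℝ) : ℂ) / (2 * (ε:ℂ)))‖ₑ ^ 2 ≤
      ∫⁻ h, ‖f (x + h) - f x‖ₑ ^ 2 ∂(gaussianReal 0 ⟨ε, hε.le⟩) := by
  set v : NNReal := ⟨ε, hε.le⟩ with hv
  have hv0 : v ≠ 0 := by
    intro h; exact hε.ne' (congrArg NNReal.toReal h)
  have hg : gaussianReal x v = (gaussianReal 0 v).map (x + ·) := by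
    rw [gaussianReal_map_const_add, zero_add]
  have e1 : ∫⁻ h, ‖f (x + h) - f x‖ₑ ^ 2 ∂(gaussianReal 0 v)
      = ∫⁻ z, ‖f z - f x‖ₑ ^ 2 ∂(gaussianReal x v) := by
    rw [hg, lintegral_map (by fun_prop) (by fun_prop)]
  rw [e1]
  refine le_trans ?_ (aux_sq _ _ (by fun_prop))
  gcongr
  rw [gaussianReal_of_var_ne_zero _ hv0,
    lintegral_withDensity_eq_lintegral_mul _ (measurable_gaussianPDF _ _) (by fun_prop),
    ← integral_const_mul]
  refine (enorm_integral_le_lintegral_enorm _).trans (lintegral_mono fun z => le_of_eq ?_)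
  have n1 : ‖Complex.exp (Complex.I * (T z : ℝ) / (ε:ℂ))‖ₑ = 1 := by
    rw [← ofReal_norm, show Complex.I * (T z : ℝ) / (ε:ℂ) = ((T z / ε : ℝ) : ℂ) * Complex.I by
      push_cast; ring, Complex.norm_exp_ofReal_mul_I, ENNReal.ofReal_one]
  have n2 : ‖Complex.exp (-(((x - z)^2 : ℝ) : ℂ) / (2 * (ε:ℂ)))‖ₑ =
      ENNReal.ofReal (Real.exp (-(z - x)^2 / (2 * ε))) := by
    rw [← ofReal_norm, show -(((x - z)^2 : ℝ) : ℂ) / (2 * (ε:ℂ)) =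
      ((-(z - x)^2 / (2 * ε) : ℝ) : ℂ) by push_cast; ring, ← Complex.ofReal_exp,
      Complex.norm_real, Real.norm_of_nonneg (Real.exp_pos _).le]
  have n3 : ‖(((2 * Real.pi * ε) ^ (-(1:ℝ)/2) : ℝ) : ℂ)‖ₑ =
      ENNReal.ofReal ((√(2 * Real.pi * ε))⁻¹) := by
    have hp : 0 ≤ 2 * Real.pi * ε := by positivity
    rw [← ofReal_norm, Complex.norm_real, Real.norm_of_nonneg (by positivity), Real.sqrt_eq_rpow,
      ← Real.rpow_neg hp, neg_div]
  simp only [enorm_mul, n1, n2, n3, mul_one, Pi.mul_apply, gaussianPDF, gaussianPDFReal]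
  rw [ENNReal.ofReal_mul (by positivity)]
  change _ = ENNReal.ofReal ((√(2 * Real.pi * ε))⁻¹) *
    ENNReal.ofReal (Real.exp (-(z - x)^2 / (2 * ε))) * _
  ring

open ProbabilityTheory in
lemma aux_tonelli (γ : Measure ℝ) [IsProbabilityMeasure γ] (G : ℝ → ℝ → ℂ)
    (hG : Continuous (fun p : ℝ × ℝ => G p.1 p.2)) (ν : Measure ℝ) [SFinite ν] :
    ∫⁻ x : ℝ, (∫⁻ y, (∫⁻ h, (∫⁻ t in Set.Ioc (0:ℝ) 1, ‖h‖ₑ ^ 2 * ‖G (x + t * h) y‖ₑ ^ 2) ∂γ) ∂ν) =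
      (∫⁻ h, ‖h‖ₑ ^ 2 ∂γ) * ∫⁻ x : ℝ, ∫⁻ y, ‖G x y‖ₑ ^ 2 ∂ν := by
  set τ := (volume : Measure ℝ).restrict (Set.Ioc (0:ℝ) 1)
  have : IsProbabilityMeasure τ := ⟨by simp [τ]⟩
  have hcomp : ∀ {α : Type} [MeasurableSpace α] (a b : α → ℝ), Measurable a → Measurable b →
      Measurable (fun p => ‖G (a p) (b p)‖ₑ ^ 2) := fun a b ha hb =>
    (hG.enorm.measurable.comp (ha.prodMk hb)).pow_const 2
  have m4 : Measurable (fun q : (ℝ × (ℝ × ℝ)) × ℝ =>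
      ‖q.1.2.1‖ₑ ^ 2 * ‖G (q.1.1 + q.1.2.2 * q.1.2.1) q.2‖ₑ ^ 2) :=
    Measurable.mul (by fun_prop) (hcomp _ _ (by fun_prop) (by fun_prop))
  calc _ = ∫⁻ x : ℝ, ∫⁻ y, ∫⁻ p : ℝ × ℝ, ‖p.1‖ₑ ^ 2 * ‖G (x + p.2 * p.1) y‖ₑ ^ 2 ∂(γ.prod τ) ∂ν := by
        refine lintegral_congr fun x => lintegral_congr fun y => ?_
        rw [lintegral_prod]
        exact (Measurable.mul (by fun_prop)
          (hcomp _ _ (by fun_prop) (by fun_prop))).aemeasurable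
    _ = ∫⁻ x : ℝ, ∫⁻ p : ℝ × ℝ, ∫⁻ y, ‖p.1‖ₑ ^ 2 * ‖G (x + p.2 * p.1) y‖ₑ ^ 2 ∂ν ∂(γ.prod τ) := by
        refine lintegral_congr fun x => ?_
        rw [lintegral_lintegral_swap]
        exact (Measurable.mul (by fun_prop)
          (hcomp _ _ (by fun_prop) (by fun_prop))).aemeasurable
    _ = ∫⁻ p : ℝ × ℝ, (∫⁻ x : ℝ, ∫⁻ y, ‖p.1‖ₑ ^ 2 * ‖G (x + p.2 * p.1) y‖ₑ ^ 2 ∂ν) ∂(γ.prod τ) := by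
        rw [lintegral_lintegral_swap]
        exact (m4.lintegral_prod_right' (ν := ν)).aemeasurable
    _ = ∫⁻ p : ℝ × ℝ, (‖p.1‖ₑ ^ 2 * ∫⁻ x : ℝ, ∫⁻ y, ‖G x y‖ₑ ^ 2 ∂ν) ∂(γ.prod τ) := by
        refine lintegral_congr fun p => ?_
        have hp : ‖p.1‖ₑ ^ 2 ≠ ⊤ := by simp
        simp_rw [lintegral_const_mul' _ _ hp]
        congr 1
        exact lintegral_add_right_eq_self (μ := volume)
          (fun x => ∫⁻ y, ‖G x y‖ₑ ^ 2 ∂ν) (p.2 * p.1)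
    _ = _ := by
        rw [lintegral_mul_const _ (by fun_prop), lintegral_prod _ (by fun_prop)]
        simp

/-- With
`I(x,y) = (2πε)^{-1/2} ∫ (g(x₀,y) − g(x,y)) e^{iT₂^{x₀}[S₀](x)/ε} e^{-(x-x₀)²/(2ε)} dx₀`,
one has `‖I‖² ≤ ε ‖∂_x g‖²`. -/
theorem initial_error_term_I
    (ε : ℝ) (hε : 0 < ε)
    (S₀ : ℝ → ℝ) (hS : ContDiff ℝ 3 S₀)
    (hSb : ∀ i ≤ 3, ∃ C : ℝ, ∀ x, |iteratedDeriv i S₀ x| ≤ C)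
    (g : ℝ → ℝ → ℂ) (hg : ContDiff ℝ 1 (fun p : ℝ × ℝ => g p.1 p.2))
    (hgsupp : ∃ K : Set ℝ, IsCompact K ∧ ∀ x ∉ K, ∀ y, g x y = 0)
    (hgper : ∀ x y, g x (y + 2 * Real.pi) = g x y) :
    L2xy (fun x y =>
        (((2 * Real.pi * ε) ^ (-(1:ℝ)/2) : ℝ) : ℂ) *
          ∫ x₀ : ℝ, (g x₀ y - g x y) * Complex.exp (Complex.I * (T2 S₀ x₀ x : ℝ) / (ε:ℂ)) *
            Complex.exp (-(((x - x₀)^2 : ℝ) : ℂ) / (2 * (ε:ℂ)))) ^ 2 ≤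
      ε * L2xy (fun x y => deriv (fun x' => g x' y) x) ^ 2 := by
  obtain ⟨K, hK, hK0⟩ := hgsupp
  set G : ℝ → ℝ → ℂ := fun x y => deriv (fun x' => g x' y) x with hGdef
  have hda : ∀ x y, HasDerivAt (fun x' => g x' y)
      (fderiv ℝ (fun p : ℝ × ℝ => g p.1 p.2) (x, y) (1, 0)) x := by
    intro x y
    have h1 := (hg.differentiable one_ne_zero (x, y)).hasFDerivAt
    have h2 : HasDerivAt (fun x' : ℝ => (x', y)) ((1:ℝ), (0:ℝ)) x :=
      (hasDerivAt_id x).prodMk (hasDerivAt_const x y)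
    exact h1.comp_hasDerivAt (f := fun x' : ℝ => (x', y)) x h2
  have hGe : ∀ x y, G x y = fderiv ℝ (fun p : ℝ × ℝ => g p.1 p.2) (x, y) (1, 0) :=
    fun x y => (hda x y).deriv
  have hGd : ∀ x y, HasDerivAt (fun x' => g x' y) (G x y) x := fun x y => by
    rw [hGe]; exact hda x y
  have hGc : Continuous (fun p : ℝ × ℝ => G p.1 p.2) := by
    simp only [hGe]
    exact (hg.continuous_fderiv one_ne_zero).clm_apply continuous_const
  have hG0 : ∀ x ∉ K, ∀ y, G x y = 0 := by
    intro x hx y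
    have : (fun x' => g x' y) =ᶠ[nhds x] fun _ => 0 := by
      filter_upwards [hK.isClosed.isOpen_compl.mem_nhds hx] with z hz
      exact hK0 z hz y
    simp only [hGdef]
    rw [this.deriv_eq]; simp
  rw [← ENNReal.ofReal_le_ofReal_iff (by positivity), ENNReal.ofReal_mul hε.le,
    aux_eq G hGc K hK hG0]
  refine (aux_le _).trans ?_
  have hga := aux_gauss ⟨ε, hε.le⟩
  change _ = ENNReal.ofReal ε at hga
  have : IsProbabilityMeasure (ProbabilityTheory.gaussianReal 0 ⟨ε, hε.le⟩) :=
    ProbabilityTheory.instIsProbabilityMeasureGaussianReal 0 ⟨ε, hε.le⟩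
  rw [← hga, ← aux_tonelli _ G hGc]
  refine lintegral_mono fun x => lintegral_mono fun y => ?_
  refine (aux_point ε hε (fun x₀ => T2 S₀ x₀ x) (fun x => g x y)
    (hg.continuous.comp (by fun_prop : Continuous fun x : ℝ => (x, y))) x).trans ?_
  refine lintegral_mono fun h => ?_
  exact aux_ftc (fun x => g x y) (fun x => G x y) (fun x => hGd x y)
    (hGc.comp (by fun_prop : Continuous fun x : ℝ => (x, y))) x h
end

section
/- Let z : ℝ × ℝ → ℂ be smooth and 2π-periodic in its second variable y, and let E : ℝ → ℝ be C², such that for every k ∈ ℝ: ½(−i∂_y + k)² z(k,·) + V(·) z(k,·) = E(k) z(k,·) on ℝ, and ∫₀^{2π} |z(k,y)|² dy = 1. Then for every k ∈ ℝ: E''(k) = 1 + 2⟨(−i∂_y + k)∂_k z(k,·), z(k,·)⟩ − 2E'(k)⟨∂_k z(k,·), z(k,·)⟩. -/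
open MeasureTheory

/-- The `L²(0,2π)` inner product `⟨f,g⟩ = ∫₀^{2π} f(y) conj(g(y)) dy`. -/
noncomputable def iprod (f g : ℝ → ℂ) : ℂ :=
  ∫ y in Set.Icc (0:ℝ) (2 * Real.pi), f y * (starRingEnd ℂ) (g y)

/-- directional derivative -/
noncomputable def dird (v : ℝ × ℝ) (f : ℝ × ℝ → ℂ) (p : ℝ × ℝ) : ℂ := fderiv ℝ f p v

lemma dird_smooth (v : ℝ × ℝ) {f : ℝ × ℝ → ℂ} (hf : ContDiff ℝ (⊤ : ℕ∞) f) :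
    ContDiff ℝ (⊤ : ℕ∞) (dird v f) := by
  have h : ContDiff ℝ (⊤ : ℕ∞) (fderiv ℝ f) := hf.fderiv_right (by simp)
  exact h.clm_apply contDiff_const

lemma smooth_diff {f : ℝ × ℝ → ℂ} (hf : ContDiff ℝ (⊤ : ℕ∞) f) : Differentiable ℝ f :=
  hf.differentiable (by simp)

lemma dird_comm (v w : ℝ × ℝ) {f : ℝ × ℝ → ℂ} (hf : ContDiff ℝ (⊤ : ℕ∞) f) :
    dird v (dird w f) = dird w (dird v f) := by
  have h : ContDiff ℝ (⊤ : ℕ∞) (fderiv ℝ f) := hf.fderiv_right (by simp)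
  have hd : Differentiable ℝ (fderiv ℝ f) := h.differentiable (by simp)
  have key : ∀ a b p, dird a (dird b f) p = fderiv ℝ (fderiv ℝ f) p a b := by
    intro a b p
    have : HasFDerivAt (dird b f) _ p :=
      (hd p).hasFDerivAt.clm_apply (hasFDerivAt_const b p)
    unfold dird at this ⊢
    rw [this.fderiv]
    simp
  funext p
  rw [key, key]
  have hs : IsSymmSndFDerivAt ℝ f p := by
    apply (hf.contDiffAt).isSymmSndFDerivAt
    simp only [minSmoothness_of_isRCLikeNormedField]
    exact WithTop.coe_le_coe.2 (le_top : (2 : ℕ∞) ≤ ⊤)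
  exact hs v w

lemma dird_k {f : ℝ × ℝ → ℂ} (hf : ContDiff ℝ (⊤ : ℕ∞) f) (k y : ℝ) :
    HasDerivAt (fun k' => f (k', y)) (dird (1, 0) f (k, y)) k := by
  have h1 : HasDerivAt (fun k' : ℝ => (k', y)) ((1 : ℝ), (0 : ℝ)) k :=
    (hasDerivAt_id k).prodMk (hasDerivAt_const k y)
  exact (smooth_diff hf (k, y)).hasFDerivAt.comp_hasDerivAt k h1

lemma dird_y {f : ℝ × ℝ → ℂ} (hf : ContDiff ℝ (⊤ : ℕ∞) f) (k y : ℝ) :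
    HasDerivAt (fun y' => f (k, y')) (dird (0, 1) f (k, y)) y := by
  have h1 : HasDerivAt (fun y' : ℝ => (k, y')) ((0 : ℝ), (1 : ℝ)) y :=
    (hasDerivAt_const y k).prodMk (hasDerivAt_id y)
  exact (smooth_diff hf (k, y)).hasFDerivAt.comp_hasDerivAt y h1

lemma dird_per (v : ℝ × ℝ) {f : ℝ × ℝ → ℂ} {c : ℝ × ℝ} (h : ∀ p, f (p + c) = f p) (p : ℝ × ℝ) :
    dird v f (p + c) = dird v f p := by
  unfold dird
  rw [← fderiv_comp_add_right, show (fun x => f (x + c)) = f from funext h]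

/-- For a normalized smooth family of Bloch eigenfunctions `z(k,·)` with
band function `E(k)`, one has
`E''(k) = 1 + 2⟨(−i∂_y+k)∂_k z, z⟩ − 2E'(k)⟨∂_k z, z⟩`. -/
theorem band_second_derivative_identity
    (V : ℝ → ℝ) (hV : Continuous V) (hVper : ∀ y, V (y + 2 * Real.pi) = V y)
    (z : ℝ → ℝ → ℂ) (hz : ContDiff ℝ (⊤ : ℕ∞) (fun p : ℝ × ℝ => z p.1 p.2))
    (hzper : ∀ k y, z k (y + 2 * Real.pi) = z k y)
    (E : ℝ → ℝ) (hE : ContDiff ℝ 2 E)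
    (heig : ∀ k y : ℝ,
      (1/2 : ℂ) * (-(deriv (fun y' => deriv (fun y'' => z k y'') y') y)
          - 2 * Complex.I * (k:ℂ) * deriv (fun y' => z k y') y
          + (k:ℂ)^2 * z k y)
        + (V y : ℂ) * z k y = ((E k : ℝ) : ℂ) * z k y)
    (hnorm : ∀ k : ℝ, ∫ y in Set.Icc (0:ℝ) (2 * Real.pi), ‖z k y‖ ^ 2 = 1) :
    ∀ k : ℝ,
      ((deriv (deriv E) k : ℝ) : ℂ) =
        1 + 2 * iprod
              (fun y => -Complex.I * deriv (fun y' => deriv (fun k' => z k' y') k) y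
                + (k:ℂ) * deriv (fun k' => z k' y) k)
              (fun y => z k y)
          - 2 * ((deriv E k : ℝ) : ℂ) *
              iprod (fun y => deriv (fun k' => z k' y) k) (fun y => z k y) := by
  obtain ⟨Z, hZ⟩ : ∃ Z : ℝ × ℝ → ℂ, Z = fun p => z p.1 p.2 := ⟨_, rfl⟩
  have hzZ : ∀ k y, z k y = Z (k, y) := by intro k y; rw [hZ]
  rw [← hZ] at hz
  simp only [hzZ] at *
  clear hZ hzZ
  have hper : ∀ p, Z (p + (0, 2 * Real.pi)) = Z p := by
    rintro ⟨k, y⟩; simpa using hzper k y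
  have hk : ∀ {f : ℝ × ℝ → ℂ}, ContDiff ℝ (⊤ : ℕ∞) f → ∀ k y,
      deriv (fun k' => f (k', y)) k = dird (1, 0) f (k, y) := fun hf k y => (dird_k hf k y).deriv
  have hy : ∀ {f : ℝ × ℝ → ℂ}, ContDiff ℝ (⊤ : ℕ∞) f → ∀ k y,
      deriv (fun y' => f (k, y')) y = dird (0, 1) f (k, y) := fun hf k y => (dird_y hf k y).deriv
  have sy := dird_smooth (0, 1) hz
  have syy := dird_smooth (0, 1) sy
  have sk := dird_smooth (1, 0) hz
  have skk := dird_smooth (1, 0) sk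
  have sky := dird_smooth (0, 1) sk
  have skyk := dird_smooth (1, 0) sky
  have skky := dird_smooth (0, 1) skk
  have skyy := dird_smooth (0, 1) sky
  have skkyy := dird_smooth (0, 1) skky
  simp only [hy hz, hy sy, hk hz, hy sk] at heig ⊢
  have c1 := dird_comm (1, 0) (0, 1) hz
  have c2 := dird_comm (1, 0) (0, 1) sy
  have c3 := dird_comm (1, 0) (0, 1) sk
  have c4 := dird_comm (1, 0) (0, 1) sky
  have hE1 : ∀ k, HasDerivAt (fun k => (E k : ℂ)) (deriv E k : ℝ) k := fun k =>
    ((hE.differentiable (by simp)) k).hasDerivAt.ofReal_comp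
  have hE2 : ∀ k, HasDerivAt (fun k => ((deriv E k : ℝ) : ℂ)) (deriv (deriv E) k : ℝ) k := fun k => by
    have h : ContDiff ℝ 1 (deriv E) := by
      have := (contDiff_succ_iff_deriv (n := 1) (𝕜 := ℝ) (f := E)).1 (by simpa [one_add_one_eq_two] using hE)
      exact this.2.2
    exact ((h.differentiable (by simp)) k).hasDerivAt.ofReal_comp
  have hid : ∀ k : ℝ, HasDerivAt (fun k : ℝ => (k : ℂ)) 1 k := fun k => by
    simpa using (hasDerivAt_id k).ofReal_comp
  have e1 : ∀ k y : ℝ, (1/2 : ℂ) * (-(dird (0,1) (dird (0,1) (dird (1,0) Z)) (k,y))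
      - 2 * Complex.I * dird (0,1) Z (k,y) - 2 * Complex.I * k * dird (0,1) (dird (1,0) Z) (k,y)
      + 2 * k * Z (k,y) + (k:ℂ)^2 * dird (1,0) Z (k,y))
      + (V y : ℂ) * dird (1,0) Z (k,y)
      - ((deriv E k : ℝ) : ℂ) * Z (k,y) - (E k : ℂ) * dird (1,0) Z (k,y) = 0 := by
    intro k y
    have H := (((((dird_k syy k y).neg.sub (((hid k).const_mul (2 * Complex.I)).mul
      (dird_k sy k y))).add (((hid k).pow 2).mul (dird_k hz k y))).const_mul (1/2 : ℂ)).add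
      ((dird_k hz k y).const_mul (V y : ℂ))).sub ((hE1 k).mul (dird_k hz k y))
    have H0 := H.unique ((hasDerivAt_const k (0:ℂ)).congr_of_eventuallyEq
      (Filter.Eventually.of_forall fun k' => by simpa using sub_eq_zero.2 (heig k' y)))
    rw [c2, c1] at H0
    rw [← H0]
    simp only [Pi.pow_apply]
    push_cast
    ring
  have e2 : ∀ k y : ℝ, (1/2 : ℂ) * (-(dird (0,1) (dird (0,1) (dird (1,0) (dird (1,0) Z))) (k,y))
      - 4 * Complex.I * dird (0,1) (dird (1,0) Z) (k,y)
      - 2 * Complex.I * k * dird (0,1) (dird (1,0) (dird (1,0) Z)) (k,y)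
      + 2 * Z (k,y) + 4 * k * dird (1,0) Z (k,y) + (k:ℂ)^2 * dird (1,0) (dird (1,0) Z) (k,y))
      + (V y : ℂ) * dird (1,0) (dird (1,0) Z) (k,y)
      - ((deriv (deriv E) k : ℝ) : ℂ) * Z (k,y) - 2 * ((deriv E k : ℝ) : ℂ) * dird (1,0) Z (k,y)
      - (E k : ℂ) * dird (1,0) (dird (1,0) Z) (k,y) = 0 := by
    intro k y
    have H := ((((((((dird_k skyy k y).neg.sub ((dird_k sy k y).const_mul (2 * Complex.I))).sub
      (((hid k).const_mul (2 * Complex.I)).mul (dird_k sky k y))).add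
      (((hid k).const_mul 2).mul (dird_k hz k y))).add
      (((hid k).pow 2).mul (dird_k sk k y))).const_mul (1/2 : ℂ)).add
      ((dird_k sk k y).const_mul (V y : ℂ))).sub ((hE2 k).mul (dird_k hz k y))).sub
      ((hE1 k).mul (dird_k sk k y))
    have H0 := H.unique ((hasDerivAt_const k (0:ℂ)).congr_of_eventuallyEq
      (Filter.Eventually.of_forall fun k' => by simpa using e1 k' y))
    rw [c4, c3, c1] at H0
    rw [← H0]
    simp only [Pi.pow_apply]
    push_cast
    ring
  intro k
  -- the boundary term
  have hconj : ∀ {f : ℝ × ℝ → ℂ}, ContDiff ℝ (⊤ : ℕ∞) f → ∀ y,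
      HasDerivAt (fun y' => (starRingEnd ℂ) (f (k, y'))) ((starRingEnd ℂ) (dird (0,1) f (k, y))) y := by
    intro f hf y
    exact (dird_y hf k y).star
  have hP := fun y : ℝ => (((((dird_y skk k y).mul (hconj sy y)).sub
    ((dird_y skky k y).mul (hconj hz y))).const_mul (1/2 : ℂ)).sub
    (((dird_y skk k y).mul (hconj hz y)).const_mul (Complex.I * k)))
  have cont : ∀ {f : ℝ × ℝ → ℂ}, ContDiff ℝ (⊤ : ℕ∞) f → Continuous fun y => f (k, y) := by
    intro f hf
    exact hf.continuous.comp (by fun_prop)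
  have ccont : ∀ {f : ℝ × ℝ → ℂ}, ContDiff ℝ (⊤ : ℕ∞) f →
      Continuous fun y => (starRingEnd ℂ) (f (k, y)) := by
    intro f hf
    exact Complex.continuous_conj.comp (cont hf)
  have k0 := cont hz
  have k1 := cont sk
  have k2 := cont sky
  have k3 := ccont hz
  have k4 := cont skk
  have k5 := cont skky
  have k6 := cont skkyy
  have k7 := ccont sy
  have k8 := ccont syy
  have hI := intervalIntegral.integral_eq_sub_of_hasDerivAt (a := 0) (b := 2 * Real.pi)
    (fun y _ => hP y) (Continuous.intervalIntegrable (by fun_prop) _ _)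
  have per : ∀ {f : ℝ × ℝ → ℂ}, (∀ p, f (p + (0, 2 * Real.pi)) = f p) →
      f (k, 2 * Real.pi) = f (k, 0) := by
    intro f hf
    simpa using hf (k, 0)
  have p0 := per hper
  have p1 := per (dird_per (0,1) hper)
  have p2 := per (dird_per (1,0) (dird_per (1,0) hper))
  have p3 := per (dird_per (0,1) (dird_per (1,0) (dird_per (1,0) hper)))
  have hn : ∫ y in (0:ℝ)..(2 * Real.pi), Z (k, y) * (starRingEnd ℂ) (Z (k, y)) = 1 := by
    rw [intervalIntegral.integral_of_le (by positivity), ← integral_Icc_eq_integral_Ioc]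
    have := congrArg (fun x : ℝ => (x : ℂ)) (hnorm k)
    beta_reduce at this
    rw [← integral_complex_ofReal] at this
    simpa [Complex.mul_conj, Complex.normSq_eq_norm_sq] using this
  unfold iprod
  rw [integral_Icc_eq_integral_Ioc, integral_Icc_eq_integral_Ioc,
    ← intervalIntegral.integral_of_le (by positivity),
    ← intervalIntegral.integral_of_le (by positivity)]
  have hcong : ∀ y : ℝ, _ = _ := fun y => show
      _ = ((deriv (deriv E) k : ℝ) - 1 : ℂ) * (Z (k, y) * (starRingEnd ℂ) (Z (k, y)))
       - 2 * ((-Complex.I * dird (0,1) (dird (1,0) Z) (k,y) + k * dird (1,0) Z (k,y))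
          * (starRingEnd ℂ) (Z (k, y)))
       + (2 * ((deriv E k : ℝ) : ℂ)) * (dird (1,0) Z (k,y) * (starRingEnd ℂ) (Z (k, y))) from by
    have h1 := e2 k y
    have h2 := congrArg (starRingEnd ℂ) (heig k y)
    simp only [map_add, map_mul, map_sub, map_neg, map_pow, Complex.conj_ofReal, Complex.conj_I,
      map_div₀, map_one, map_ofNat] at h2
    refine Eq.trans (b := dird (0,1) (dird (1,0) (dird (1,0) Z)) (k,y) * 0 + (1 / 2 : ℂ) *
      (dird (1,0) (dird (1,0) Z) (k,y) * (starRingEnd ℂ) (dird (0,1) (dird (0,1) Z) (k,y))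
       - dird (0,1) (dird (0,1) (dird (1,0) (dird (1,0) Z))) (k,y) * (starRingEnd ℂ) (Z (k,y)))
      - Complex.I * k * (dird (0,1) (dird (1,0) (dird (1,0) Z)) (k,y) * (starRingEnd ℂ) (Z (k,y))
      + dird (1,0) (dird (1,0) Z) (k,y) * (starRingEnd ℂ) (dird (0,1) Z (k,y)))) rfl ?_
    linear_combination (starRingEnd ℂ) (Z (k, y)) * h1 - dird (1,0) (dird (1,0) Z) (k,y) * h2
  have hI2 := (intervalIntegral.integral_congr (a := 0) (b := 2 * Real.pi) (μ := volume)
    (fun y _ => hcong y)).symm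
  rw [intervalIntegral.integral_add (Continuous.intervalIntegrable (by fun_prop) _ _)
    (Continuous.intervalIntegrable (by fun_prop) _ _),
    intervalIntegral.integral_sub (Continuous.intervalIntegrable (by fun_prop) _ _)
    (Continuous.intervalIntegrable (by fun_prop) _ _),
    intervalIntegral.integral_const_mul, intervalIntegral.integral_const_mul,
    intervalIntegral.integral_const_mul, hn] at hI2
  have hI3 : ∫ y in (0:ℝ)..(2 * Real.pi), (dird (0,1) (dird (1,0) (dird (1,0) Z)) (k,y) * 0 + (1 / 2 : ℂ) *
      (dird (1,0) (dird (1,0) Z) (k,y) * (starRingEnd ℂ) (dird (0,1) (dird (0,1) Z) (k,y))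
       - dird (0,1) (dird (0,1) (dird (1,0) (dird (1,0) Z))) (k,y) * (starRingEnd ℂ) (Z (k,y)))
      - Complex.I * k * (dird (0,1) (dird (1,0) (dird (1,0) Z)) (k,y) * (starRingEnd ℂ) (Z (k,y))
      + dird (1,0) (dird (1,0) Z) (k,y) * (starRingEnd ℂ) (dird (0,1) Z (k,y)))) = 0 := by
    rw [intervalIntegral.integral_congr (fun y _ => ?_), hI]
    · simp [p0, p1, p2, p3]
    · beta_reduce
      ring
  rw [hI3] at hI2
  linear_combination hI2
end

section
/- Let T > 0, let x̃, p : [0,T] → ℝ be C¹ with x̃'(t) = E'(p(t)) and p'(t) = −V_e'(x̃(t)), and let M : [0,T] → ℂ and a : [0,T] → ℂ be C¹. Set k(t,x) = p(t) + M(t)(x − x̃(t)), A₀(t,x,y) = a(t) z(k(t,x), y) (defined for x with k(t,x) ∈ U), and (L A₀)(t,x,y) = ∂_t A₀ − i ∂_y ∂_x A₀ + k(t,x) ∂_x A₀ + ½ M(t) A₀. Then for every t ∈ [0,T]: ⟨(L A₀)(t, x̃(t), ·), z(p(t), ·)⟩ = a'(t) + a(t) ( ½ E''(p(t)) M(t)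 − V_e'(x̃(t)) ⟨∂_k z(p(t),·), z(p(t),·)⟩ ). Consequently, ⟨(L A₀)(t, x̃(t), ·), z(p(t),·)⟩ = 0 for all t ∈ [0,T] if and only if a satisfies the amplitude equation a'(t) = a(t) ( V_e'(x̃(t)) ⟨∂_k z(p(t),·), z(p(t),·)⟩ − ½ E''(p(t)) M(t) ) on [0,T]. -/
open MeasureTheory

/-- The Gaussian beam complex momentum `k(t,x) = p(t) + M(t)(x − x̃(t))`. -/
noncomputable def beamK (p xt : ℝ → ℝ) (M : ℝ → ℂ) (t x : ℝ) : ℂ :=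
  ((p t : ℝ) : ℂ) + M t * ((x : ℂ) - ((xt t : ℝ) : ℂ))

/-- The leading amplitude `A₀(t,x,y) = a(t) z(k(t,x), y)`. -/
noncomputable def beamA0 (z : ℂ → ℝ → ℂ) (a : ℝ → ℂ) (p xt : ℝ → ℝ) (M : ℝ → ℂ)
    (t x y : ℝ) : ℂ :=
  a t * z (beamK p xt M t x) y

/-- `(L A₀)(t,x,y) = ∂_t A₀ − i ∂_y∂_x A₀ + k(t,x) ∂_x A₀ + ½ M(t) A₀`. -/
noncomputable def beamLA0 (z : ℂ → ℝ → ℂ) (a : ℝ → ℂ) (p xt : ℝ → ℝ) (M : ℝ → ℂ)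
    (t x y : ℝ) : ℂ :=
  deriv (fun t' => beamA0 z a p xt M t' x y) t
    - Complex.I * deriv (fun y' => deriv (fun x' => beamA0 z a p xt M t x' y') x) y
    + beamK p xt M t x * deriv (fun x' => beamA0 z a p xt M t x' y) x
    + (1/2 : ℂ) * M t * beamA0 z a p xt M t x y

section helpers

variable {U : Set ℂ} {z : ℂ → ℝ → ℂ}

lemma aux_zy (hzsmooth : ContDiffOn ℝ (⊤ : ℕ∞) (fun q : ℂ × ℝ => z q.1 q.2) (U ×ˢ Set.univ))
    {k : ℂ} (hk : k ∈ U) : ContDiff ℝ (⊤ : ℕ∞) (z k) := by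
  have h : ContDiffOn ℝ (⊤ : ℕ∞) (fun y : ℝ => ((k, y) : ℂ × ℝ)) Set.univ :=
    (contDiff_const.prodMk contDiff_id).contDiffOn
  have := hzsmooth.comp h (fun y _ => ⟨hk, trivial⟩)
  exact contDiffOn_univ.1 this

lemma aux_zeta (hU : IsOpen U)
    (hzhol : ∀ y : ℝ, DifferentiableOn ℂ (fun k => z k y) U)
    (hzsmooth : ContDiffOn ℝ (⊤ : ℕ∞) (fun q : ℂ × ℝ => z q.1 q.2) (U ×ˢ Set.univ)) :
    ContDiffOn ℝ (⊤ : ℕ∞) (fun q : ℂ × ℝ => deriv (fun k' => z k' q.2) q.1)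
      (U ×ˢ Set.univ) := by
  have ho : IsOpen (U ×ˢ (Set.univ : Set ℝ)) := hU.prod isOpen_univ
  have h1 : ContDiffOn ℝ (⊤ : ℕ∞)
      (fun q : ℂ × ℝ => fderiv ℝ (fun q : ℂ × ℝ => z q.1 q.2) q (1, 0)) (U ×ˢ Set.univ) :=
    (hzsmooth.fderiv_of_isOpen ho (m := (⊤ : ℕ∞)) (by simp)).clm_apply contDiffOn_const
  refine h1.congr ?_
  rintro ⟨k, y⟩ ⟨hk, -⟩
  have hd : HasDerivAt (fun k' => z k' y) (deriv (fun k' => z k' y) k) k :=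
    ((hzhol y).differentiableAt (hU.mem_nhds hk)).hasDerivAt
  have hF : HasFDerivAt (fun q : ℂ × ℝ => z q.1 q.2)
      (fderiv ℝ (fun q : ℂ × ℝ => z q.1 q.2) (k, y)) (k, y) :=
    ((hzsmooth.contDiffAt (ho.mem_nhds ⟨hk, trivial⟩)).differentiableAt (by simp)).hasFDerivAt
  have hl : HasDerivAt (fun s : ℝ => ((k + (s : ℂ), y) : ℂ × ℝ)) (1, 0) 0 := by
    refine HasDerivAt.prodMk ?_ (hasDerivAt_const _ _)
    exact (Complex.ofRealCLM.hasDerivAt (x := (0 : ℝ))).const_add k |>.congr_deriv (by simp)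
  have e1 : HasDerivAt (fun s : ℝ => z (k + (s : ℂ)) y)
      (fderiv ℝ (fun q : ℂ × ℝ => z q.1 q.2) (k, y) (1, 0)) 0 := by
    have hF' : HasFDerivAt (fun q : ℂ × ℝ => z q.1 q.2)
      (fderiv ℝ (fun q : ℂ × ℝ => z q.1 q.2) (k, y)) ((k + ((0 : ℝ) : ℂ), y) : ℂ × ℝ) := by
      simpa using hF
    exact hF'.comp_hasDerivAt (0 : ℝ) hl
  have e2 : HasDerivAt (fun s : ℝ => z (k + (s : ℂ)) y) (deriv (fun k' => z k' y) k) 0 := by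
    have hd' : HasDerivAt (fun k' => z k' y) (deriv (fun k' => z k' y) k)
      (k + ((0 : ℝ) : ℂ)) := by simpa using hd
    have hl' : HasDerivAt (fun s : ℝ => (k + (s : ℂ))) 1 0 :=
      (Complex.ofRealCLM.hasDerivAt (x := (0 : ℝ))).const_add k |>.congr_deriv (by simp)
    have h3 := hd'.scomp (0 : ℝ) hl'
    rw [one_smul] at h3
    exact h3
  exact e2.unique e1

lemma aux_param (hU : IsOpen U)
    (hzhol : ∀ y : ℝ, DifferentiableOn ℂ (fun k => z k y) U)
    (hzsmooth : ContDiffOn ℝ (⊤ : ℕ∞) (fun q : ℂ × ℝ => z q.1 q.2) (U ×ˢ Set.univ))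
    {w : ℝ → ℂ} (hw : Continuous w) (b : ℝ) {k : ℂ} (hk : k ∈ U) :
    HasDerivAt (fun k => ∫ y in (0:ℝ)..b, z k y * w y)
      (∫ y in (0:ℝ)..b, deriv (fun k' => z k' y) k * w y) k := by
  have hz := (aux_zeta hU hzhol hzsmooth).continuousOn
  obtain ⟨r, hr, hball⟩ := Metric.nhds_basis_closedBall.mem_iff.1 (hU.mem_nhds hk)
  have hcomp : IsCompact (Metric.closedBall k r ×ˢ Set.uIcc 0 b) :=
    (isCompact_closedBall k r).prod isCompact_uIcc
  have hcont : ContinuousOn (fun q : ℂ × ℝ => deriv (fun k' => z k' q.2) q.1 * w q.2)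
      (Metric.closedBall k r ×ˢ Set.uIcc 0 b) :=
    (hz.mono (Set.prod_mono hball (Set.subset_univ _))).mul
      (hw.comp continuous_snd).continuousOn
  obtain ⟨C, hC⟩ := hcomp.exists_bound_of_continuousOn hcont
  have hzc : ∀ k ∈ U, Continuous (fun y => z k y * w y) := fun k hk =>
    (aux_zy hzsmooth hk).continuous.mul hw
  have hζc : Continuous (fun y => deriv (fun k' => z k' y) k * w y) :=
    (aux_zy (z := fun k y => deriv (fun k' => z k' y) k)
      (aux_zeta hU hzhol hzsmooth) hk).continuous.mul hw
  refine (intervalIntegral.hasDerivAt_integral_of_dominated_loc_of_deriv_le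
    (F := fun k y => z k y * w y) (F' := fun k y => deriv (fun k' => z k' y) k * w y)
    (bound := fun _ => C) (s := Metric.ball k r) (Metric.ball_mem_nhds k hr) ?_ ?_ ?_ ?_ ?_ ?_).2
  · filter_upwards [hU.mem_nhds hk] with k' hk'
    exact (hzc k' hk').aestronglyMeasurable
  · exact (hzc k hk).intervalIntegrable _ _
  · exact hζc.aestronglyMeasurable
  · refine Filter.Eventually.of_forall fun y hy k' hk' => ?_
    exact hC (k', y) ⟨Metric.ball_subset_closedBall hk', Set.uIoc_subset_uIcc hy⟩
  · exact intervalIntegrable_const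
  · refine Filter.Eventually.of_forall fun y hy k' hk' => ?_
    exact (((hzhol y).differentiableAt
      (hU.mem_nhds (hball (Metric.ball_subset_closedBall hk')))).hasDerivAt).mul_const _

lemma aux_second (hU : IsOpen U) {κ : ℂ} (hκ : κ ∈ U) {E G P : ℂ → ℂ}
    (hE : DifferentiableOn ℂ E U) (hG : DifferentiableOn ℂ G U) (hP : DifferentiableOn ℂ P U)
    (h : ∀ k ∈ U, 2 * Complex.I * (k - κ) * P k
      + (k ^ 2 - κ ^ 2 - 2 * (E k - E κ)) * G k = 0) :
    4 * Complex.I * deriv P κ + (2 - 2 * deriv (deriv E) κ) * G κ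
      + 2 * (2 * κ - 2 * deriv E κ) * deriv G κ = 0 := by
  have hd : ∀ {f : ℂ → ℂ}, DifferentiableOn ℂ f U → ∀ k ∈ U, HasDerivAt f (deriv f k) k :=
    fun hf k hk => (hf.differentiableAt (hU.mem_nhds hk)).hasDerivAt
  have h1 : ∀ k ∈ U, 2 * Complex.I * P k + 2 * Complex.I * (k - κ) * deriv P k
      + ((2 * k - 2 * deriv E k) * G k
        + (k ^ 2 - κ ^ 2 - 2 * (E k - E κ)) * deriv G k) = 0 := by
    intro k hk
    have A := ((((hasDerivAt_id k).sub_const κ).const_mul (2 * Complex.I)).mul (hd hP k hk)).add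
      (((((hasDerivAt_id k).pow 2).sub_const (κ ^ 2)).sub
        (((hd hE k hk).sub_const (E κ)).const_mul 2)).mul (hd hG k hk))
    have B : HasDerivAt (fun k => 2 * Complex.I * (k - κ) * P k
      + (k ^ 2 - κ ^ 2 - 2 * (E k - E κ)) * G k) 0 k :=
      (hasDerivAt_const k (0:ℂ)).congr_of_eventuallyEq
        (Filter.eventuallyEq_of_mem (hU.mem_nhds hk) h)
    have := A.unique B
    simp at this
    linear_combination this
  have A := ((hd hP κ hκ).const_mul (2 * Complex.I)).add
      ((((hasDerivAt_id κ).sub_const κ).const_mul (2 * Complex.I)).mul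
        (hd (hP.deriv hU) κ hκ)) |>.add
      (((((hasDerivAt_id κ).const_mul 2).sub ((hd (hE.deriv hU) κ hκ).const_mul 2)).mul
        (hd hG κ hκ)).add
      (((((hasDerivAt_id κ).pow 2).sub_const (κ ^ 2)).sub
        (((hd hE κ hκ).sub_const (E κ)).const_mul 2)).mul (hd (hG.deriv hU) κ hκ)))
  have B : HasDerivAt (fun k => 2 * Complex.I * P k + 2 * Complex.I * (k - κ) * deriv P k
      + ((2 * k - 2 * deriv E k) * G k
        + (k ^ 2 - κ ^ 2 - 2 * (E k - E κ)) * deriv G k)) 0 κ :=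
      (hasDerivAt_const κ (0:ℂ)).congr_of_eventuallyEq
        (Filter.eventuallyEq_of_mem (hU.mem_nhds hκ) h1)
  have := A.unique B
  simp at this
  linear_combination this

lemma aux_key (V : ℝ → ℝ) (hU : IsOpen U) (hUR : ∀ x : ℝ, (x : ℂ) ∈ U)
    (hzhol : ∀ y : ℝ, DifferentiableOn ℂ (fun k => z k y) U)
    (hzsmooth : ContDiffOn ℝ (⊤ : ℕ∞) (fun q : ℂ × ℝ => z q.1 q.2) (U ×ˢ Set.univ))
    (hzper : ∀ k y, z k (y + 2 * Real.pi) = z k y)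
    (E : ℂ → ℂ) (hEhol : DifferentiableOn ℂ E U)
    (hEreal : ∀ x : ℝ, (E (x : ℂ)).im = 0)
    (heig : ∀ k ∈ U, ∀ y : ℝ,
      (1/2 : ℂ) * (-(deriv (fun y' => deriv (fun y'' => z k y'') y') y)
          - 2 * Complex.I * k * deriv (fun y' => z k y') y + k^2 * z k y)
        + (V y : ℂ) * z k y = E k * z k y)
    (hG1 : ∀ x : ℝ, ∫ y in (0:ℝ)..(2 * Real.pi), z x y * (starRingEnd ℂ) (z x y) = 1) (κ : ℝ) :
    -Complex.I * (∫ y in (0:ℝ)..(2 * Real.pi),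
        deriv (fun y => deriv (fun k' => z k' y) κ) y * (starRingEnd ℂ) (z κ y))
      + (κ - deriv E κ) * (∫ y in (0:ℝ)..(2 * Real.pi),
        deriv (fun k' => z k' y) κ * (starRingEnd ℂ) (z κ y))
      = 1 / 2 * (deriv (deriv E) κ - 1) := by
  have hκ := hUR κ
  have hs : ∀ k ∈ U, ContDiff ℝ (⊤ : ℕ∞) (z k) := fun k hk => aux_zy hzsmooth hk
  have hs1 : ∀ k ∈ U, ContDiff ℝ (⊤ : ℕ∞) (deriv (z k)) := fun k hk =>
    ((contDiff_infty_iff_deriv.1 (hs k hk))).2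
  have hd1 : ∀ k ∈ U, ∀ y, HasDerivAt (z k) (deriv (z k) y) y := fun k hk y =>
    ((hs k hk).differentiable (by simp) y).hasDerivAt
  have hd2 : ∀ k ∈ U, ∀ y, HasDerivAt (deriv (z k)) (deriv (deriv (z k)) y) y := fun k hk y =>
    ((hs1 k hk).differentiable (by simp) y).hasDerivAt
  have hsζ : ContDiff ℝ (⊤ : ℕ∞) (fun y => deriv (fun k' => z k' y) κ) :=
    aux_zy (z := fun k y => deriv (fun k' => z k' y) k) (aux_zeta hU hzhol hzsmooth) hκ
  set Zb : ℝ → ℂ := fun y => (starRingEnd ℂ) (z κ y) with hZb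
  set Zb1 : ℝ → ℂ := fun y => (starRingEnd ℂ) (deriv (z κ) y) with hZb1
  have hZc : Continuous Zb := Complex.continuous_conj.comp (hs κ hκ).continuous
  have hZ1c : Continuous Zb1 := Complex.continuous_conj.comp (hs1 κ hκ).continuous
  have hZd : ∀ y, HasDerivAt Zb (Zb1 y) y := fun y => (hd1 κ hκ y).star
  have hZ1d : ∀ y, HasDerivAt Zb1 ((starRingEnd ℂ) (deriv (deriv (z κ)) y)) y :=
    fun y => (hd2 κ hκ y).star
  have hEκ : (starRingEnd ℂ) (E κ) = E κ := Complex.conj_eq_iff_im.2 (hEreal κ)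
  have hper1 : ∀ k, deriv (z k) (2 * Real.pi) = deriv (z k) 0 := by
    intro k
    have : (fun y => z k (y + 2 * Real.pi)) = z k := funext (hzper k)
    have h2 := deriv_comp_add_const (z k) (2 * Real.pi) 0
    rw [this] at h2
    simpa using h2.symm
  have hper0 : ∀ k, z k (2 * Real.pi) = z k 0 := fun k => by simpa using hzper k 0
  set G : ℂ → ℂ := fun k => ∫ y in (0:ℝ)..(2 * Real.pi), z k y * Zb y with hG
  set P : ℂ → ℂ := fun k => ∫ y in (0:ℝ)..(2 * Real.pi), z k y * Zb1 y with hP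
  have hGd : ∀ k ∈ U, HasDerivAt G _ k := fun k hk =>
    aux_param hU hzhol hzsmooth hZc (2 * Real.pi) hk
  have hPd : ∀ k ∈ U, HasDerivAt P _ k := fun k hk =>
    aux_param hU hzhol hzsmooth hZ1c (2 * Real.pi) hk
  have hid : ∀ k ∈ U, 2 * Complex.I * (k - κ) * P k
      + (k ^ 2 - (κ : ℂ) ^ 2 - 2 * (E k - E κ)) * G k = 0 := by
    intro k hk
    have hW : ∀ y ∈ Set.uIcc 0 (2 * Real.pi),
        HasDerivAt (fun y => deriv (z k) y * Zb y - z k y * Zb1 y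
          + 2 * Complex.I * k * (z k y * Zb y))
        (2 * Complex.I * (k - κ) * (z k y * Zb1 y)
          + (k ^ 2 - (κ : ℂ) ^ 2 - 2 * (E k - E κ)) * (z k y * Zb y)) y := by
      intro y _
      have h := (((hd2 k hk y).mul (hZd y)).sub ((hd1 k hk y).mul (hZ1d y))).add
        (((hd1 k hk y).mul (hZd y)).const_mul (2 * Complex.I * k))
      refine h.congr_deriv ?_
      have e1 := heig k hk y
      have e2 := congrArg (starRingEnd ℂ) (heig κ hκ y)
      simp only [map_add, map_sub, map_mul, map_neg, map_pow, map_div₀, map_one, map_ofNat,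
        Complex.conj_I, Complex.conj_ofReal, hEκ] at e2
      change _ * (-(deriv (deriv (z k)) y) - _ * deriv (z k) y + _) + _ = _ at e1
      change _ * (-((starRingEnd ℂ) (deriv (deriv (z κ)) y)) - _ * Zb1 y + _ * Zb y) + _ * Zb y
        = _ * Zb y at e2
      linear_combination (-2 * Zb y) * e1 + (2 * z k y) * e2
    have hc : Continuous (fun y => 2 * Complex.I * (k - κ) * (z k y * Zb1 y)
          + (k ^ 2 - (κ : ℂ) ^ 2 - 2 * (E k - E κ)) * (z k y * Zb y)) := by
      have := (hs k hk).continuous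
      fun_prop
    have hc1 : Continuous (fun y => z k y * Zb1 y) := (hs k hk).continuous.mul hZ1c
    have hc0 : Continuous (fun y => z k y * Zb y) := (hs k hk).continuous.mul hZc
    have := intervalIntegral.integral_eq_sub_of_hasDerivAt hW (hc.intervalIntegrable _ _)
    rw [intervalIntegral.integral_add ((hc1.intervalIntegrable _ _).const_mul _)
      ((hc0.intervalIntegrable _ _).const_mul _), intervalIntegral.integral_const_mul,
      intervalIntegral.integral_const_mul] at this
    rw [hG, hP]
    simp only
    rw [this]
    simp only [hZb, hZb1, hper0, hper1]
    ring
  have hsec := aux_second hU hκ hEhol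
    (fun k hk => (hGd k hk).differentiableAt.differentiableWithinAt)
    (fun k hk => (hPd k hk).differentiableAt.differentiableWithinAt) hid
  rw [(hGd κ hκ).deriv, (hPd κ hκ).deriv] at hsec
  have hζper : deriv (fun k' => z k' (2 * Real.pi)) κ = deriv (fun k' => z k' 0) κ := by
    simp only [hper0]
  have hζd : ∀ y, HasDerivAt (fun y => deriv (fun k' => z k' y) κ)
      (deriv (fun y => deriv (fun k' => z k' y) κ) y) y := fun y =>
    (hsζ.differentiable (by simp) y).hasDerivAt
  have hIBP := intervalIntegral.integral_mul_deriv_eq_deriv_mul (a := 0) (b := 2 * Real.pi)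
    (u := fun y => deriv (fun k' => z k' y) κ) (v := Zb) (v' := Zb1)
    (fun y _ => hζd y) (fun y _ => hZd y)
    ((contDiff_infty_iff_deriv.1 hsζ).2.continuous.intervalIntegrable _ _)
    (hZ1c.intervalIntegrable _ _)
  have hb : Zb (2 * Real.pi) = Zb 0 := by simp only [hZb, hper0]
  rw [hIBP, hζper, hb] at hsec
  have hG1' : G κ = 1 := hG1 κ
  rw [hG1'] at hsec
  linear_combination (1 / 4 : ℂ) * hsec

end helpers

/-- **Lemma 3.1, amplitude equation.** Along the central ray,
`⟨LA₀, z⟩ = a' + a(½E''(p)M − V_e'(x̃)⟨z_k, z⟩)`; consequently `⟨LA₀, z⟩ ≡ 0` iff `a`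
satisfies the amplitude equation. -/
theorem amplitude_equation
    (V : ℝ → ℝ) (hV : Continuous V) (hVper : ∀ y, V (y + 2 * Real.pi) = V y)
    (Ve : ℝ → ℝ) (hVe : ContDiff ℝ 1 Ve)
    (U : Set ℂ) (hU : IsOpen U) (hUR : ∀ x : ℝ, (x : ℂ) ∈ U)
    (z : ℂ → ℝ → ℂ)
    (hzhol : ∀ y : ℝ, DifferentiableOn ℂ (fun k => z k y) U)
    (hzsmooth : ContDiffOn ℝ (⊤ : ℕ∞) (fun q : ℂ × ℝ => z q.1 q.2) (U ×ˢ Set.univ))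
    (hzper : ∀ k y, z k (y + 2 * Real.pi) = z k y)
    (E : ℂ → ℂ) (hEhol : DifferentiableOn ℂ E U)
    (hEreal : ∀ x : ℝ, (E (x : ℂ)).im = 0)
    (heig : ∀ k ∈ U, ∀ y : ℝ,
      (1/2 : ℂ) * (-(deriv (fun y' => deriv (fun y'' => z k y'') y') y)
          - 2 * Complex.I * k * deriv (fun y' => z k y') y + k^2 * z k y)
        + (V y : ℂ) * z k y = E k * z k y)
    (hnorm : ∀ x : ℝ, ∫ y in Set.Icc (0:ℝ) (2 * Real.pi), ‖z (x : ℂ) y‖ ^ 2 = 1)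
    (T : ℝ) (hT : 0 < T)
    (xt p : ℝ → ℝ) (hxt : ContDiff ℝ 1 xt) (hp : ContDiff ℝ 1 p)
    (hode1 : ∀ t ∈ Set.Icc (0:ℝ) T, ((deriv xt t : ℝ) : ℂ) = deriv E ((p t : ℝ) : ℂ))
    (hode2 : ∀ t ∈ Set.Icc (0:ℝ) T, deriv p t = -deriv Ve (xt t))
    (M a : ℝ → ℂ) (hM : ContDiff ℝ 1 M) (ha : ContDiff ℝ 1 a) :
    (∀ t ∈ Set.Icc (0:ℝ) T,
      iprod (fun y => beamLA0 z a p xt M t (xt t) y) (fun y => z ((p t : ℝ) : ℂ) y)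
        = deriv a t + a t *
            ((1/2 : ℂ) * deriv (deriv E) ((p t : ℝ) : ℂ) * M t
              - ((deriv Ve (xt t) : ℝ) : ℂ) *
                iprod (fun y => deriv (fun k' => z k' y) ((p t : ℝ) : ℂ))
                  (fun y => z ((p t : ℝ) : ℂ) y)))
    ∧
    ((∀ t ∈ Set.Icc (0:ℝ) T,
        iprod (fun y => beamLA0 z a p xt M t (xt t) y) (fun y => z ((p t : ℝ) : ℂ) y) = 0)
      ↔ (∀ t ∈ Set.Icc (0:ℝ) T,
          deriv a t = a t *
            (((deriv Ve (xt t) : ℝ) : ℂ) *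
                iprod (fun y => deriv (fun k' => z k' y) ((p t : ℝ) : ℂ))
                  (fun y => z ((p t : ℝ) : ℂ) y)
              - (1/2 : ℂ) * deriv (deriv E) ((p t : ℝ) : ℂ) * M t))) := by
  have main : ∀ t ∈ Set.Icc (0:ℝ) T,
      iprod (fun y => beamLA0 z a p xt M t (xt t) y) (fun y => z ((p t : ℝ) : ℂ) y)
        = deriv a t + a t *
            ((1/2 : ℂ) * deriv (deriv E) ((p t : ℝ) : ℂ) * M t
              - ((deriv Ve (xt t) : ℝ) : ℂ) *
                iprod (fun y => deriv (fun k' => z k' y) ((p t : ℝ) : ℂ))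
                  (fun y => z ((p t : ℝ) : ℂ) y)) := by
    intro t ht
    have hconv : ∀ f : ℝ → ℂ, ∫ y in Set.Icc (0:ℝ) (2 * Real.pi), f y
        = ∫ y in (0:ℝ)..(2 * Real.pi), f y := fun f => by
      rw [intervalIntegral.integral_of_le (by positivity), integral_Icc_eq_integral_Ioc]
    have hG1 : ∀ x : ℝ,
        ∫ y in (0:ℝ)..(2 * Real.pi), z x y * (starRingEnd ℂ) (z x y) = 1 := by
      intro x
      rw [← hconv]
      have : (fun y => z x y * (starRingEnd ℂ) (z x y))
          = fun y => (((‖z x y‖ ^ 2 : ℝ)) : ℂ) := by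
        funext y
        rw [Complex.mul_conj']
        push_cast
        rfl
      rw [this]
      refine (integral_ofReal (𝕜 := ℂ) (f := fun y => ‖z x y‖ ^ 2)).trans ?_
      rw [hnorm x]
      simp
    have key := aux_key V hU hUR hzhol hzsmooth hzper E hEhol hEreal heig hG1 (p t)
    have hκ := hUR (p t)
    have hK : ∀ x, HasDerivAt (fun x' : ℝ => beamK p xt M t x') (M t) x := by
      intro x
      have h0 : HasDerivAt (fun s : ℝ => (s : ℂ)) 1 x := by
        exact (Complex.ofRealCLM.hasDerivAt (x := x)).congr_deriv (by simp)
      exact (((h0.sub_const (xt t : ℂ)).const_mul (M t)).const_add (p t : ℂ)).congr_deriv (by simp)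
    have hK0 : beamK p xt M t (xt t) = p t := by simp [beamK]
    have hζ : ∀ y, HasDerivAt (fun k' => z k' y) (deriv (fun k' => z k' y) (p t)) (p t) :=
      fun y => ((hzhol y).differentiableAt (hU.mem_nhds hκ)).hasDerivAt
    have hx : ∀ y, deriv (fun x' => beamA0 z a p xt M t x' y) (xt t)
        = a t * M t * deriv (fun k' => z k' y) (p t) := by
      intro y
      have h1 := hζ y
      rw [← hK0] at h1
      have h2 := (h1.scomp (xt t) (hK (xt t))).const_mul (a t)
      rw [hK0] at h2
      have h3 : HasDerivAt (fun x' => beamA0 z a p xt M t x' y) _ (xt t) := h2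
      rw [h3.deriv, smul_eq_mul]
      ring
    have hKt : HasDerivAt (fun t' : ℝ => beamK p xt M t' (xt t))
        ((deriv p t : ℝ) - M t * (deriv xt t : ℝ)) t := by
      have hp1 : HasDerivAt (fun s => ((p s : ℝ) : ℂ)) ((deriv p t : ℝ) : ℂ) t :=
        (hp.differentiable (by simp) t).hasDerivAt.ofReal_comp
      have hx1 : HasDerivAt (fun s => ((xt s : ℝ) : ℂ)) ((deriv xt t : ℝ) : ℂ) t :=
        (hxt.differentiable (by simp) t).hasDerivAt.ofReal_comp
      have hM1 := (hM.differentiable (by simp) t).hasDerivAt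
      refine (hp1.add (hM1.mul (hx1.const_sub ((xt t : ℝ) : ℂ)))).congr_deriv ?_
      simp
      ring
    have htd : ∀ y, deriv (fun t' => beamA0 z a p xt M t' (xt t) y) t
        = deriv a t * z (p t) y + a t * (((deriv p t : ℝ) - M t * (deriv xt t : ℝ))
          * deriv (fun k' => z k' y) (p t)) := by
      intro y
      have h1 := hζ y
      rw [← hK0] at h1
      have h2 := (ha.differentiable (by simp) t).hasDerivAt.mul (h1.scomp t hKt)
      have h3 : HasDerivAt (fun t' => beamA0 z a p xt M t' (xt t) y) _ t := h2
      rw [h3.deriv, smul_eq_mul]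
      simp only [Function.comp, hK0]
    have hsζ : ContDiff ℝ (⊤ : ℕ∞) (fun y => deriv (fun k' => z k' y) (p t)) :=
      aux_zy (z := fun k y => deriv (fun k' => z k' y) k) (aux_zeta hU hzhol hzsmooth) hκ
    have hzc : Continuous (fun y => (starRingEnd ℂ) (z (p t) y)) :=
      Complex.continuous_conj.comp (aux_zy hzsmooth hκ).continuous
    have hL : ∀ y, beamLA0 z a p xt M t (xt t) y * (starRingEnd ℂ) (z (p t) y)
        = (deriv a t + 1 / 2 * M t * a t) * (z (p t) y * (starRingEnd ℂ) (z (p t) y))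
          + a t * ((deriv p t : ℝ) + M t * (p t - deriv E (p t)))
            * (deriv (fun k' => z k' y) (p t) * (starRingEnd ℂ) (z (p t) y))
          + a t * M t * (-Complex.I)
            * (deriv (fun y => deriv (fun k' => z k' y) (p t)) y
              * (starRingEnd ℂ) (z (p t) y)) := by
      intro y
      unfold beamLA0
      simp only [hx, htd, hK0]
      rw [deriv_const_mul_field, hode1 t ht]
      simp only [beamA0, hK0]
      ring
    unfold iprod
    simp only [hL]
    rw [hconv, hconv]
    have c1 : IntervalIntegrable (fun y => z (p t) y * (starRingEnd ℂ) (z (p t) y))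
        volume 0 (2 * Real.pi) :=
      ((aux_zy hzsmooth hκ).continuous.mul hzc).intervalIntegrable _ _
    have c2 : IntervalIntegrable
        (fun y => deriv (fun k' => z k' y) (p t) * (starRingEnd ℂ) (z (p t) y))
        volume 0 (2 * Real.pi) := (hsζ.continuous.mul hzc).intervalIntegrable _ _
    have c3 : IntervalIntegrable
        (fun y => deriv (fun y => deriv (fun k' => z k' y) (p t)) y * (starRingEnd ℂ) (z (p t) y))
        volume 0 (2 * Real.pi) :=
      ((contDiff_infty_iff_deriv.1 hsζ).2.continuous.mul hzc).intervalIntegrable _ _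
    rw [intervalIntegral.integral_add ((c1.const_mul _).add (c2.const_mul _)) (c3.const_mul _),
      intervalIntegral.integral_add (c1.const_mul _) (c2.const_mul _),
      intervalIntegral.integral_const_mul, intervalIntegral.integral_const_mul,
      intervalIntegral.integral_const_mul, hG1, hode2 t ht]
    push_cast
    linear_combination (a t * M t) * key
  refine ⟨main, ?_⟩
  constructor
  · intro h t ht
    have h1 := main t ht
    rw [h t ht] at h1
    linear_combination -h1
  · intro h t ht
    rw [main t ht, h t ht]
    ring
end

section
/- For every δ > 0 and all nonnegative integers p, q there exists a constant C = C(δ,p,q) such that for all ε > 0 and all a, b ∈ ℝ: ∫_ℝ |x−a|^p |x−b|^q e^{−(δ/ε)((x−a)² + (x−b)²)} dx ≤ C ε^{(p+q+1)/2} e^{−δ(a−b)²/(4ε)}. -/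
open MeasureTheory

lemma aux_pow (δ : ℝ) (hδ : 0 < δ) (n : ℕ) (r t : ℝ) (hr : 0 < r) (ht : 0 ≤ t) :
    t ^ n ≤ r ^ n * ((n.factorial : ℝ) * Real.exp (1/δ)) * Real.exp (δ / r^2 * t^2 / 4) := by
  obtain ⟨u, hu, rfl⟩ : ∃ u : ℝ, 0 ≤ u ∧ t = r * u := ⟨t / r, by positivity, by field_simp⟩
  have h1 : u ≤ δ * u^2/4 + 1/δ := by
    have : δ * u^2/4 + 1/δ - u = (δ*u-2)^2/(4*δ) := by field_simp; ring
    have h2 : 0 ≤ (δ*u-2)^2/(4*δ) := by positivity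
    linarith
  have h3 := Real.pow_div_factorial_le_exp (δ * u^2/4 + 1/δ) (by positivity) n
  rw [div_le_iff₀ (by positivity), Real.exp_add] at h3
  have h4 : u ^ n ≤ (δ * u^2/4 + 1/δ)^n := pow_le_pow_left₀ hu h1 n
  have h5 : δ / r^2 * (r*u)^2 / 4 = δ * u^2/4 := by field_simp
  rw [h5, mul_pow, mul_assoc]
  refine mul_le_mul_of_nonneg_left ?_ (by positivity)
  linarith

/-- Gaussian moment bound: for `δ > 0` and nonnegative integers `p, q`
there is `C = C(δ,p,q)` with
`∫_ℝ |x−a|^p |x−b|^q e^{−(δ/ε)((x−a)²+(x−b)²)} dx ≤ C ε^{(p+q+1)/2} e^{−δ(a−b)²/(4ε)}`. -/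
theorem gaussian_moment_bound (δ : ℝ) (hδ : 0 < δ) (p q : ℕ) :
    ∃ C : ℝ, ∀ ε : ℝ, 0 < ε → ∀ a b : ℝ,
      (∫ x : ℝ, |x - a| ^ p * |x - b| ^ q *
          Real.exp (-(δ/ε) * ((x - a)^2 + (x - b)^2))) ≤
        C * ε ^ (((p : ℝ) + (q : ℝ) + 1)/2) * Real.exp (-δ * (a - b)^2 / (4 * ε)) := by
  set K : ℕ → ℝ := fun n => (n.factorial : ℝ) * Real.exp (1/δ) with hK
  have hKpos : ∀ n, 0 ≤ K n := fun n => by simp only [hK]; positivity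
  refine ⟨K p * K q * √(Real.pi / (δ/4)), fun ε hε a b => ?_⟩
  have hr : 0 < √ε := Real.sqrt_pos.2 hε
  have hr2 : √ε ^ 2 = ε := Real.sq_sqrt hε.le
  have hpow : ε ^ (((p : ℝ) + (q : ℝ) + 1)/2) = √ε ^ p * √ε ^ q * √ε := by
    have : √ε ^ p * √ε ^ q * √ε = √ε ^ (p+q+1) := by ring
    rw [this, Real.sqrt_eq_rpow, ← Real.rpow_natCast, ← Real.rpow_mul hε.le]
    congr 1; push_cast; ring
  have hint : Integrable fun x : ℝ => Real.exp (-(δ/(4*ε)) * (x - a)^2) :=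
    (integrable_exp_neg_mul_sq (b := δ/(4*ε)) (by positivity)).comp_sub_right a
  have hval : ∫ x : ℝ, Real.exp (-(δ/(4*ε)) * (x - a)^2) = √(Real.pi / (δ/4)) * √ε := by
    rw [integral_sub_right_eq_self (μ := volume)
      (fun x : ℝ => Real.exp (-(δ/(4*ε)) * x^2)) a, integral_gaussian,
      ← Real.sqrt_mul (by positivity)]
    congr 1; field_simp
  set M : ℝ := √ε ^ p * K p * (√ε ^ q * K q) * Real.exp (-δ * (a - b)^2 / (4 * ε)) with hM
  have hbound : ∀ x : ℝ, |x - a| ^ p * |x - b| ^ q *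
      Real.exp (-(δ/ε) * ((x - a)^2 + (x - b)^2)) ≤
      M * Real.exp (-(δ/(4*ε)) * (x - a)^2) := by
    intro x
    have ha := aux_pow δ hδ p _ _ hr (abs_nonneg (x - a))
    have hb := aux_pow δ hδ q _ _ hr (abs_nonneg (x - b))
    rw [hr2, sq_abs] at ha hb
    have hexp : Real.exp (δ / ε * (x-a)^2 / 4) * Real.exp (δ / ε * (x-b)^2 / 4) *
        Real.exp (-(δ/ε) * ((x - a)^2 + (x - b)^2)) ≤
        Real.exp (-δ * (a - b)^2 / (4 * ε)) * Real.exp (-(δ/(4*ε)) * (x - a)^2) := by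
      rw [← Real.exp_add, ← Real.exp_add, ← Real.exp_add, Real.exp_le_exp]
      have e1 : -δ * (a - b)^2 / (4 * ε) = δ/ε * (-(a-b)^2/4) := by field_simp
      have e2 : -(δ/(4*ε)) * (x - a)^2 = δ/ε * (-(x-a)^2/4) := by field_simp
      have hc : 0 ≤ δ/ε := by positivity
      have h0 : 0 ≤ (x-a)^2/2 + 3*(x-b)^2/4 - (a-b)^2/4 := by
        nlinarith [sq_nonneg ((x-a)+(x-b)), sq_nonneg (x-b)]
      rw [e1, e2]
      nlinarith [mul_nonneg hc h0]
    calc _ ≤ (√ε ^ p * K p * Real.exp (δ / ε * (x-a)^2 / 4)) *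
          (√ε ^ q * K q * Real.exp (δ / ε * (x-b)^2 / 4)) *
          Real.exp (-(δ/ε) * ((x - a)^2 + (x - b)^2)) := by
          have := hKpos p
          gcongr
      _ = (√ε ^ p * K p * (√ε ^ q * K q)) * (Real.exp (δ / ε * (x-a)^2 / 4) *
          Real.exp (δ / ε * (x-b)^2 / 4) *
          Real.exp (-(δ/ε) * ((x - a)^2 + (x - b)^2))) := by ring
      _ ≤ _ := by
          rw [hM, mul_assoc (√ε ^ p * K p * (√ε ^ q * K q))]
          have := hKpos p
          have := hKpos q
          exact mul_le_mul_of_nonneg_left hexp (by positivity)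
  calc _ ≤ ∫ x : ℝ, M * Real.exp (-(δ/(4*ε)) * (x - a)^2) :=
        integral_mono_of_nonneg (Filter.Eventually.of_forall fun x => by
          simp only [Pi.zero_apply]; positivity) (hint.const_mul M)
          (Filter.Eventually.of_forall hbound)
    _ = _ := by
        rw [integral_const_mul, hval, hpow, hM]; ring
end

section
/- Let K₀ ⊂ ℝ be a bounded measurable set, let c > 0, and let K ≥ 2 be an integer. Then there exists a constant C, depending only on K₀, c and K, such that for all ε with 0 < ε ≤ 1: ∫_{K₀} ∫_{K₀} 1 / ( 1 + ( c |x₀ − x₀'| / √ε )^K ) dx₀ dx₀' ≤ C ε^{1/2}. -/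
open MeasureTheory

lemma aux_pt_s16 (t : ℝ) (ht : 0 ≤ t) (K : ℕ) (hK : 2 ≤ K) :
    1 / (1 + t ^ K) ≤ 2 * (1 + t ^ 2)⁻¹ := by
  have h0 : 0 ≤ t ^ K := pow_nonneg ht K
  rw [← div_eq_mul_inv, div_le_div_iff₀ (by positivity) (by positivity)]
  rcases le_total t 1 with h | h
  · nlinarith
  · have := pow_le_pow_right₀ h hK
    nlinarith

lemma aux_inner (S : Set ℝ) (a : ℝ) (ha : 0 < a) (y : ℝ) (K : ℕ) (hK : 2 ≤ K) :
    ‖∫ x in S, 1 / (1 + (a * |x - y|) ^ K)‖ ≤ 2 * (a⁻¹ * Real.pi) := by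
  have hi : Integrable (fun x : ℝ => 2 * (1 + (a * (x - y)) ^ 2)⁻¹) := by
    have h1 : Integrable (fun x : ℝ => (1 + (a * x) ^ 2)⁻¹) :=
      integrable_inv_one_add_sq.comp_mul_left' ha.ne'
    exact (h1.comp_sub_right y).const_mul 2
  have hnn : ∀ x : ℝ, 0 ≤ 1 / (1 + (a * |x - y|) ^ K) := fun x => by positivity
  rw [Real.norm_of_nonneg (integral_nonneg hnn)]
  calc _ ≤ ∫ x in S, 2 * (1 + (a * (x - y)) ^ 2)⁻¹ := by
        refine integral_mono_of_nonneg (.of_forall hnn) hi.integrableOn (.of_forall fun x => ?_)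
        have := aux_pt_s16 (a * |x - y|) (by positivity) K hK
        simpa [mul_pow] using this
    _ ≤ ∫ x, 2 * (1 + (a * (x - y)) ^ 2)⁻¹ :=
        setIntegral_le_integral hi (.of_forall fun x => by positivity)
    _ = 2 * (a⁻¹ * Real.pi) := by
        rw [integral_const_mul, integral_sub_right_eq_self (fun x : ℝ => (1 + (a * x) ^ 2)⁻¹) y,
          Measure.integral_comp_mul_left (fun x : ℝ => (1 + x ^ 2)⁻¹) a,
          integral_univ_inv_one_add_sq, abs_of_pos (inv_pos.2 ha), smul_eq_mul]

/-- For a bounded measurable set `K₀ ⊂ ℝ`, `c > 0` and integer `K ≥ 2`,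
`∫_{K₀}∫_{K₀} (1 + (c|x₀−x₀'|/√ε)^K)⁻¹ dx₀ dx₀' ≤ C ε^{1/2}` for `0 < ε ≤ 1`. -/
theorem double_rational_bound (K₀ : Set ℝ) (hK₀b : Bornology.IsBounded K₀)
    (hK₀m : MeasurableSet K₀) (c : ℝ) (hc : 0 < c) (K : ℕ) (hK : 2 ≤ K) :
    ∃ C : ℝ, ∀ ε : ℝ, 0 < ε → ε ≤ 1 →
      (∫ x₀' in K₀, ∫ x₀ in K₀,
          1 / (1 + (c * |x₀ - x₀'| / Real.sqrt ε) ^ K)) ≤ C * ε ^ ((1:ℝ)/2) := by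
  refine ⟨2 * (c⁻¹ * Real.pi) * volume.real K₀, fun ε hε _ => ?_⟩
  have hs : 0 < Real.sqrt ε := Real.sqrt_pos.2 hε
  rw [← Real.sqrt_eq_rpow]
  simp_rw [mul_div_right_comm c]
  refine (le_abs_self _).trans ((norm_setIntegral_le_of_norm_le_const hK₀b.measure_lt_top
    (fun y _ => aux_inner K₀ (c / Real.sqrt ε) (by positivity) y K hK)).trans (le_of_eq ?_))
  field_simp
end

section
/- There exist constants θ > 0 and C > 0 such that for every t ∈ [0,T], every pair x₀, x₀' ∈ K₀ satisfying |x̃(t;x₀) − x̃(t;x₀')| < θ |x₀ − x₀'|, and every x ∈ ℝ: |∂_x ψ(t,x;x₀,x₀')| ≥ C |x₀ − x₀'|, where ∂_x ψ(t,x;x₀,x₀') = p(t;x₀) − p(t;x₀') + M(t;x₀)(x − x̃(t;x₀)) − conj(M(t;x₀'))(x − x̃(t;x₀')). -/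
open MeasureTheory

lemma lip_deriv_aux (f : ℝ → ℝ) (hf : ContDiff ℝ 3 f)
    (hb : ∃ C : ℝ, ∀ x, |iteratedDeriv 2 f x| ≤ C) :
    ∃ L : NNReal, LipschitzWith L (deriv f) := by
  obtain ⟨C, hC⟩ := hb
  have h0 : 0 ≤ C := le_trans (abs_nonneg _) (hC 0)
  have h1 : iteratedDeriv 2 f = deriv (deriv f) := by
    rw [iteratedDeriv_succ, iteratedDeriv_one]
  have hd : ContDiff ℝ 2 (deriv f) := by
    have : ContDiff ℝ (2 + 1) f := by
      convert hf using 1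
      norm_num
    exact (contDiff_succ_iff_deriv.1 this).2.2
  refine ⟨C.toNNReal, lipschitzWith_of_nnnorm_deriv_le (hd.differentiable (by norm_num)) ?_⟩
  intro x
  rw [← NNReal.coe_le_coe, Real.coe_toNNReal C h0]
  have := hC x
  rw [h1] at this
  simpa using this

lemma alg_aux (m B c d D w : ℝ) (a b a' b' u P y : ℝ) (hm : 0 < m) (hB : 0 < B)
    (hb : m ≤ b) (hb' : m ≤ b') (hbB' : b' ≤ B) (ha : |a| ≤ B) (ha' : |a'| ≤ B)
    (hP : c * d ≤ |P|) (hy : |y| ≤ w)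
    (hw : (m * B + B * B) * w ≤ m * c * d / 2)
    (hre : |P + a * u - a' * (u + y)| ≤ D) (him : |b * u + b' * (u + y)| ≤ D) :
    m * c / (2 * (m + B)) * d ≤ D := by
  have h1 : |P| ≤ D + 2 * B * |u| + B * w := by
    have e : P = (P + a * u - a' * (u + y)) - a * u + a' * u + a' * y := by ring
    have t1 : |a * u| ≤ B * |u| := by rw [abs_mul]; gcongr
    have t2 : |a' * u| ≤ B * |u| := by rw [abs_mul]; gcongr
    have t3 : |a' * y| ≤ B * w := by rw [abs_mul]; gcongr
    rw [e]
    rw [abs_le] at *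
    constructor <;> linarith
  have h2 : 2 * m * |u| ≤ D + B * w := by
    have t3 : |b' * y| ≤ B * w := by
      rw [abs_mul, abs_of_pos (lt_of_lt_of_le hm hb')]; gcongr
    have e : |(b + b') * u| = (b + b') * |u| := by
      rw [abs_mul, abs_of_pos (by linarith)]
    have t4 : |(b + b') * u| ≤ D + B * w := by
      have e : (b + b') * u = (b * u + b' * (u + y)) - b' * y := by ring
      rw [e]
      rw [abs_le] at *
      constructor <;> linarith
    rw [e] at t4
    nlinarith [abs_nonneg u]
  have h3 : m * (c * d) ≤ m * (D + 2 * B * |u| + B * w) :=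
    mul_le_mul_of_nonneg_left (hP.trans h1) hm.le
  have h4 := mul_le_mul_of_nonneg_left h2 hB.le
  have h5 : m * c * d / 2 ≤ (m + B) * D := by nlinarith
  rw [div_mul_eq_mul_div, div_le_iff₀ (by positivity)]
  linarith

/-- **Phase estimate.** For Gaussian beam components
`(x̃(t;x₀), p(t;x₀), M(t;x₀))` solving the beam ODE system on `[0,T]` with
`Im M > 0`, there exist `θ > 0` and `C > 0` such that whenever
`|x̃(t;x₀) − x̃(t;x₀')| < θ|x₀ − x₀'|` one has, for every `x`,
`|∂_x ψ(t,x;x₀,x₀')| ≥ C|x₀ − x₀'|`, where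
`∂_xψ = p(t;x₀) − p(t;x₀') + M(t;x₀)(x − x̃(t;x₀)) − conj(M(t;x₀'))(x − x̃(t;x₀'))`. -/
theorem phase_estimate
    (E Ve S₀ : ℝ → ℝ)
    (hE : ContDiff ℝ 3 E) (hEb : ∀ i ≤ 3, ∃ C : ℝ, ∀ x, |iteratedDeriv i E x| ≤ C)
    (hVe : ContDiff ℝ 3 Ve) (hVeb : ∀ i ≤ 3, ∃ C : ℝ, ∀ x, |iteratedDeriv i Ve x| ≤ C)
    (hS : ContDiff ℝ 3 S₀) (hSb : ∀ i ≤ 3, ∃ C : ℝ, ∀ x, |iteratedDeriv i S₀ x| ≤ C)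
    (K₀ : Set ℝ) (hK₀ : IsCompact K₀) (T : ℝ) (hT : 0 < T)
    (xt p : ℝ → ℝ → ℝ) (M : ℝ → ℝ → ℂ)
    (hode_x : ∀ x₀ ∈ K₀, ∀ t ∈ Set.Icc (0:ℝ) T,
      HasDerivAt (fun s => xt s x₀) (deriv E (p t x₀)) t)
    (hode_p : ∀ x₀ ∈ K₀, ∀ t ∈ Set.Icc (0:ℝ) T,
      HasDerivAt (fun s => p s x₀) (-(deriv Ve (xt t x₀))) t)
    (hode_M : ∀ x₀ ∈ K₀, ∀ t ∈ Set.Icc (0:ℝ) T,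
      HasDerivAt (fun s => M s x₀)
        (-((deriv (deriv E) (p t x₀) : ℝ) : ℂ) * (M t x₀)^2
          - ((deriv (deriv Ve) (xt t x₀) : ℝ) : ℂ)) t)
    (hinit_x : ∀ x₀ ∈ K₀, xt 0 x₀ = x₀)
    (hinit_p : ∀ x₀ ∈ K₀, p 0 x₀ = deriv S₀ x₀)
    (hinit_M : ∀ x₀ ∈ K₀, M 0 x₀ = ((deriv (deriv S₀) x₀ : ℝ) : ℂ) + Complex.I)
    (hcont : ContinuousOn (fun q : ℝ × ℝ => (xt q.1 q.2, p q.1 q.2, M q.1 q.2))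
      (Set.Icc (0:ℝ) T ×ˢ K₀))
    (hImM : ∀ t ∈ Set.Icc (0:ℝ) T, ∀ x₀ ∈ K₀, 0 < (M t x₀).im) :
    ∃ θ > (0:ℝ), ∃ C > (0:ℝ), ∀ t ∈ Set.Icc (0:ℝ) T, ∀ x₀ ∈ K₀, ∀ x₀' ∈ K₀,
      |xt t x₀ - xt t x₀'| < θ * |x₀ - x₀'| → ∀ x : ℝ,
        C * |x₀ - x₀'| ≤
          ‖((p t x₀ : ℝ) : ℂ) - ((p t x₀' : ℝ) : ℂ)
            + M t x₀ * ((x : ℂ) - ((xt t x₀ : ℝ) : ℂ))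
            - (starRingEnd ℂ) (M t x₀') * ((x : ℂ) - ((xt t x₀' : ℝ) : ℂ))‖ := by
  obtain ⟨L1, hL1⟩ := lip_deriv_aux E hE (hEb 2 (by norm_num))
  obtain ⟨L2, hL2⟩ := lip_deriv_aux Ve hVe (hVeb 2 (by norm_num))
  have hcM : ContinuousOn (fun q : ℝ × ℝ => M q.1 q.2) (Set.Icc (0:ℝ) T ×ˢ K₀) :=
    hcont.snd.snd
  have hcomp : IsCompact (Set.Icc (0:ℝ) T ×ˢ K₀) := isCompact_Icc.prod hK₀
  obtain ⟨B0, hB0⟩ := hcomp.exists_bound_of_continuousOn hcM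
  have hcIm : ContinuousOn (fun q : ℝ × ℝ => ((M q.1 q.2).im)⁻¹) (Set.Icc (0:ℝ) T ×ˢ K₀) :=
    (Complex.continuous_im.comp_continuousOn hcM).inv₀
      (fun q hq => (hImM q.1 hq.1 q.2 hq.2).ne')
  obtain ⟨R0, hR0⟩ := hcomp.exists_bound_of_continuousOn hcIm
  obtain ⟨B, hBpos, hB⟩ : ∃ B > 0, ∀ t ∈ Set.Icc (0:ℝ) T, ∀ x₀ ∈ K₀, ‖M t x₀‖ ≤ B :=
    ⟨max B0 1, by positivity, fun t ht x hx => (hB0 (t, x) ⟨ht, hx⟩).trans (le_max_left _ _)⟩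
  obtain ⟨m, hm, hmb⟩ : ∃ m > 0, ∀ t ∈ Set.Icc (0:ℝ) T, ∀ x₀ ∈ K₀, m ≤ (M t x₀).im := by
    refine ⟨(max R0 1)⁻¹, by positivity, fun t ht x hx => ?_⟩
    have h1 := (hR0 (t, x) ⟨ht, hx⟩).trans (le_max_left R0 1)
    have h2 := hImM t ht x hx
    simp only [Real.norm_eq_abs] at h1
    exact inv_le_of_inv_le₀ h2 ((le_abs_self _).trans h1)
  -- backward Gronwall estimate
  obtain ⟨c, hc, hgr⟩ : ∃ c > 0, ∀ t ∈ Set.Icc (0:ℝ) T, ∀ x₀ ∈ K₀, ∀ x₀' ∈ K₀,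
      c * |x₀ - x₀'| ≤ max |xt t x₀ - xt t x₀'| |p t x₀ - p t x₀'| := by
    set L : NNReal := max L1 L2 with hL
    refine ⟨Real.exp (-(L * T)), Real.exp_pos _, fun t ht x hx y hy => ?_⟩
    have key : ∀ z ∈ K₀, ∀ s ∈ Set.Icc (0:ℝ) t,
        HasDerivAt (fun s => (xt (t - s) z, p (t - s) z))
          ((fun _ q => (-(deriv E q.2), deriv Ve q.1) : ℝ → ℝ × ℝ → ℝ × ℝ) s
            (xt (t - s) z, p (t - s) z)) s := by
      intro z hz s hs
      have hs' : t - s ∈ Set.Icc (0:ℝ) T := ⟨by linarith [hs.2], by linarith [hs.1, ht.2]⟩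
      have d1 := (hode_x z hz (t - s) hs').comp_const_sub t s
      have d2 := (hode_p z hz (t - s) hs').comp_const_sub t s
      rw [neg_neg] at d2
      exact d1.prodMk d2
    have hv : ∀ s : ℝ, LipschitzWith L
        ((fun _ q => (-(deriv E q.2), deriv Ve q.1) : ℝ → ℝ × ℝ → ℝ × ℝ) s) := by
      intro s
      have a1 : LipschitzWith L1 (fun q : ℝ × ℝ => -(deriv E q.2)) := by
        have h := hL1.comp (LipschitzWith.prod_snd (α := ℝ) (β := ℝ))
        rw [mul_one] at h
        exact h.neg
      have a2 : LipschitzWith L2 (fun q : ℝ × ℝ => deriv Ve q.1) := by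
        have h := hL2.comp (LipschitzWith.prod_fst (α := ℝ) (β := ℝ))
        rw [mul_one] at h
        exact h
      exact a1.prodMk a2
    have g := dist_le_of_trajectories_ODE (a := 0) (b := t) hv
      (fun s hs => (key x hx s hs).continuousAt.continuousWithinAt)
      (fun s hs => (key x hx s ⟨hs.1, hs.2.le⟩).hasDerivWithinAt)
      (fun s hs => (key y hy s hs).continuousAt.continuousWithinAt)
      (fun s hs => (key y hy s ⟨hs.1, hs.2.le⟩).hasDerivWithinAt)
      (le_refl _) t ⟨ht.1, le_refl _⟩
    simp only [sub_self, sub_zero, Prod.dist_eq, Real.dist_eq] at g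
    rw [hinit_x x hx, hinit_x y hy] at g
    have g1 := (le_max_left _ _).trans g
    have g2 : Real.exp (L * t) ≤ Real.exp (L * T) :=
      Real.exp_le_exp.2 (mul_le_mul_of_nonneg_left ht.2 L.2)
    rw [Real.exp_neg, inv_mul_le_iff₀ (Real.exp_pos _), mul_comm (Real.exp _)]
    exact g1.trans (mul_le_mul_of_nonneg_left g2 (by positivity))
  have hX : 0 < m * B + B * B + m := by positivity
  refine ⟨m * c / (4 * (m * B + B * B + m)), by positivity, m * c / (2 * (m + B)),
    by positivity, ?_⟩
  intro t ht x₀ hx₀ x₀' hx₀' hlt x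
  set θ := m * c / (4 * (m * B + B * B + m)) with hθ
  have hd := abs_nonneg (x₀ - x₀')
  have hθX : θ * (m * B + B * B + m) = m * c / 4 := by
    rw [hθ]; field_simp
  have hθ0 : 0 < θ := by positivity
  have hθc : θ ≤ c := by
    have : 0 < m * B + B * B := by positivity
    have : m * θ ≤ m * c := by nlinarith [mul_pos hm hc]
    exact le_of_mul_le_mul_left this hm
  have hP : c * |x₀ - x₀'| ≤ |p t x₀ - p t x₀'| := by
    rcases le_max_iff.1 (hgr t ht x₀ hx₀ x₀' hx₀') with h | h
    · have := mul_le_mul_of_nonneg_right hθc hd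
      linarith
    · exact h
  refine alg_aux m B c |x₀ - x₀'| _ (θ * |x₀ - x₀'|) (M t x₀).re (M t x₀).im (M t x₀').re
    (M t x₀').im (x - xt t x₀) (p t x₀ - p t x₀') (xt t x₀ - xt t x₀') hm hBpos
    (hmb t ht x₀ hx₀) (hmb t ht x₀' hx₀')
    ((Complex.im_le_norm _).trans (hB t ht x₀' hx₀'))
    ((Complex.abs_re_le_norm _).trans (hB t ht x₀ hx₀))
    ((Complex.abs_re_le_norm _).trans (hB t ht x₀' hx₀')) hP hlt.le ?_ ?_ ?_
  · have h1 : (m * B + B * B) * θ ≤ m * c / 2 := by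
      nlinarith [mul_pos hm hc, mul_pos hm hθ0]
    have := mul_le_mul_of_nonneg_right h1 hd
    linarith
  · refine le_trans (le_of_eq ?_) (Complex.abs_re_le_norm _)
    congr 1
    simp
  · refine le_trans (le_of_eq ?_) (Complex.abs_im_le_norm _)
    congr 1
    simp
end
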